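/- arXiv:2208.05936 — 3 statements merged into one kernel-verified Lean document; each statement's English description precedes it below -/
import Mathlib

section
/- Aliased component formula: Let f be a Schwartz function on ℝ², let ψ ∈ C^∞(S¹) be even, let m ≥ 1 and k be integers, and let x ∈ ℝ². Then the 2mk-th angular Fourier coefficient of φ ↦ ψ(ω(φ)) G_f(ω(φ), x·ω(φ)) satisfies ∫_0^{2π} e^{−2 i m k φ} ψ(ω(φ)) G_f(ω(φ), x·ω(φ)) dφ = (1/(4π²)) ∫_{ℝ²} e^{i x·ξ} ψ(ξ/|ξ|) e^{−2 i m k·arg(ξ)} 𝓕f(ξ) dξ. -/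
open MeasureTheory Real intervalIntegral
open scoped RealInnerProductSpace

noncomputable section

/-- The plane `ℝ²` as a Euclidean space. -/
abbrev E2 : Type := EuclideanSpace ℝ (Fin 2)

/-- The unit vector `ω(φ) = (cos φ, sin φ)`. -/
def omega (φ : ℝ) : E2 := (WithLp.equiv 2 (Fin 2 → ℝ)).symm ![Real.cos φ, Real.sin φ]

/-- Identify `ξ ∈ ℝ²` with the complex number `ξ₁ + i ξ₂`; its argument is the
polar angle of `ξ`.  For `n ∈ ℤ`, `e^{i n·arg ξ}` does not depend on the branch
of the argument. -/
def toC (ξ : E2) : ℂ := (ξ 0 : ℂ) + (ξ 1 : ℂ) * Complex.I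

/-- The Fourier transform on `ℝ²`: `𝓕f(ξ) = ∫ e^{−i x·ξ} f(x) dx`. -/
def FT (f : E2 → ℂ) (ξ : E2) : ℂ :=
  ∫ x : E2, Complex.exp (-(Complex.I * (⟪x, ξ⟫ : ℂ))) * f x

/-- The filtered projection `G_f(ω,p) = (1/(8π²)) ∫ e^{i p q} |q| 𝓕f(qω) dq`,
which equals `ℋℛf` by the Fourier slice theorem. -/
def filtProj (f : E2 → ℂ) (w : E2) (p : ℝ) : ℂ :=
  (1 / (8 * (π : ℂ) ^ 2)) * ∫ q : ℝ, Complex.exp (Complex.I * p * q) * (|q| : ℝ) * FT f (q • w)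

lemma omega_add_pi (φ : ℝ) : omega (φ + π) = -omega φ := by
  ext i
  fin_cases i <;> simp [omega]

lemma norm_omega (φ : ℝ) : ‖omega φ‖ = 1 := by
  simp [omega, EuclideanSpace.norm_eq]

lemma continuous_omega : Continuous omega := by
  refine (PiLp.continuous_toLp 2 (fun _ : Fin 2 => ℝ)).comp (continuous_pi fun i => ?_)
  fin_cases i
  · exact Real.continuous_cos
  · exact Real.continuous_sin

lemma toC_smul_omega (r φ : ℝ) :
    toC (r • omega φ) = r * (Complex.cos φ + Complex.sin φ * Complex.I) := by
  simp [toC, omega]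
  ring

/-- Integration over the plane in polar coordinates. -/
lemma integral_eq_integral_polar (Φ : E2 → ℂ) :
    ∫ ξ, Φ ξ = ∫ p in Set.Ioi (0 : ℝ) ×ˢ Set.Ioo (-π) π, (p.1 : ℂ) * Φ (p.1 • omega p.2) := by
  have hmp := Complex.orthonormalBasisOneI.repr.measurePreserving
  rw [← hmp.integral_comp Complex.orthonormalBasisOneI.repr.toHomeomorph.measurableEmbedding,
    ← Complex.integral_comp_polarCoord_symm]
  refine integral_congr_ae (Filter.Eventually.of_forall fun p => ?_)
  have : Complex.orthonormalBasisOneI.repr (Complex.polarCoord.symm p) = p.1 • omega p.2 := by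
    ext i
    rw [Complex.orthonormalBasisOneI_repr_apply]
    fin_cases i <;>
      simp [omega, Complex.cos_ofReal_re, Complex.sin_ofReal_re]
  simp only [this, Complex.real_smul]

/-- The Fourier transform of a Schwartz function on the plane is a Schwartz function. -/
lemma exists_schwartzMap_eq_FT (f : SchwartzMap E2 ℂ) : ∃ g : SchwartzMap E2 ℂ, ⇑g = FT f := by
  have h : (2 * π)⁻¹ ≠ (0 : ℝ) := by positivity
  refine ⟨SchwartzMap.compCLMOfContinuousLinearEquiv ℝ
    (ContinuousLinearEquiv.smulLeft (Units.mk0 _ h) : E2 ≃L[ℝ] E2) (FourierTransform.fourier f), ?_⟩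
  ext ξ
  change (FourierTransform.fourier (f : E2 → ℂ)) ((2 * π)⁻¹ • ξ) = _
  rw [Real.fourier_eq', FT]
  refine integral_congr_ae (Filter.Eventually.of_forall fun x => ?_)
  simp only [inner_smul_right, smul_eq_mul]
  congr 2
  push_cast
  have : (π : ℂ) ≠ 0 := by exact_mod_cast Real.pi_ne_zero
  field_simp

section Polar

variable {A : ℝ → ℂ} {h : E2 → ℂ} {C : ℝ}

lemma norm_polar_le (hb : ∀ ξ, (1 + ‖ξ‖) ^ 3 * ‖h ξ‖ ≤ C) (q φ : ℝ) :
    ‖((|q| : ℝ) : ℂ) * h (q • omega φ)‖ ≤ C * (1 + ‖q‖) ^ (-2 : ℝ) := by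
  have h1 := hb (q • omega φ)
  rw [norm_smul, norm_omega, mul_one, Real.norm_eq_abs] at h1
  have h0 := abs_nonneg q
  rw [norm_mul, Complex.norm_real, Real.norm_eq_abs, Real.norm_eq_abs, abs_abs,
    Real.rpow_neg (by positivity), ← div_eq_mul_inv, le_div_iff₀ (by positivity)]
  norm_cast
  refine le_trans ?_ h1
  have h2 : |q| * (1 + |q|) ^ 2 ≤ (1 + |q|) ^ 3 := by nlinarith [sq_nonneg (1 + |q|)]
  calc _ = (|q| * (1 + |q|) ^ 2) * ‖h (q • omega φ)‖ := by ring
    _ ≤ _ := by gcongr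

/-- The polar integrand is integrable over bounded ranges of the angle. -/
lemma integrable_polar (hA : Continuous A) (hh : Continuous h)
    (hb : ∀ ξ, (1 + ‖ξ‖) ^ 3 * ‖h ξ‖ ≤ C) {s : Set ℝ} (hs : Bornology.IsBounded s) (t : Set ℝ) :
    Integrable (fun p : ℝ × ℝ => A p.1 * ((|p.2| : ℝ) * h (p.2 • omega p.1)))
      ((volume.restrict s).prod (volume.restrict t)) := by
  have hs' : IntegrableOn A s :=
    (hA.continuousOn.integrableOn_compact hs.isCompact_closure).mono_set subset_closure
  have hq : Integrable (fun q : ℝ => C * (1 + ‖q‖) ^ (-2 : ℝ)) (volume.restrict t) :=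
    ((integrable_one_add_norm (by simp)).const_mul C).integrableOn
  refine (hs'.norm.mul_prod hq).mono' ?_ (Filter.Eventually.of_forall fun p => ?_)
  · have := continuous_omega
    exact Continuous.aestronglyMeasurable (by fun_prop)
  · rw [norm_mul]
    gcongr
    exact norm_polar_le hb _ _

/-- Integrating a `π`-periodic weight over all lines through the origin covers the plane twice. -/
lemma integral_lines_eq_two_mul_integral (hA : Continuous A) (hper : Function.Periodic A π)
    (hh : Continuous h) (hb : ∀ ξ, (1 + ‖ξ‖) ^ 3 * ‖h ξ‖ ≤ C) {Φ : E2 → ℂ}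
    (hΦ : ∀ r > (0 : ℝ), ∀ θ ∈ Set.Ioo (-π) π, Φ (r • omega θ) = A θ * h (r • omega θ)) :
    ∫ φ in (0 : ℝ)..(2 * π), A φ * ∫ q : ℝ, (|q| : ℝ) * h (q • omega φ) = 2 * ∫ ξ, Φ ξ := by
  set B : ℝ → ℂ := fun φ => ∫ q in Set.Ioi (0 : ℝ), A φ * ((|q| : ℝ) * h (q • omega φ)) with hB
  have hline : ∀ φ, A φ * ∫ q : ℝ, (|q| : ℝ) * h (q • omega φ) = B φ + B (φ + π) := by
    intro φ
    have hi : Integrable fun q : ℝ => ((|q| : ℝ) : ℂ) * h (q • omega φ) := by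
      have hq : Integrable (fun q : ℝ => C * (1 + ‖q‖) ^ (-2 : ℝ)) :=
        (integrable_one_add_norm (by simp)).const_mul C
      have := continuous_omega
      exact hq.mono' (Continuous.aestronglyMeasurable (by fun_prop))
        (Filter.Eventually.of_forall fun q => norm_polar_le hb q φ)
    rw [← intervalIntegral.integral_Iic_add_Ioi (b := 0) hi.integrableOn hi.integrableOn]
    have hneg := integral_comp_neg_Ioi 0 fun q : ℝ => ((|q| : ℝ) : ℂ) * h (q • omega φ)
    rw [neg_zero] at hneg
    rw [← hneg, mul_add, add_comm, ← MeasureTheory.integral_const_mul,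
      ← MeasureTheory.integral_const_mul]
    simp only [hB, hper φ, omega_add_pi, abs_neg, neg_smul, smul_neg]
  have hBi : ∀ a b, IntervalIntegrable B volume a b := fun a b => by
    rw [intervalIntegrable_iff]
    exact (integrable_polar hA hh hb (Metric.isBounded_Ioc _ _) _).integral_prod_left
  have hBper : Function.Periodic B (2 * π) := by
    intro φ
    have h1 : omega (φ + 2 * π) = omega φ := by
      rw [two_mul, ← add_assoc, omega_add_pi, omega_add_pi, neg_neg]
    have h2 : A (φ + 2 * π) = A φ := by rw [two_mul, ← add_assoc, hper, hper]
    simp only [hB, h1, h2]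
  have hshift : ∫ φ in (0 : ℝ)..(2 * π), B (φ + π) = ∫ φ in (0 : ℝ)..(2 * π), B φ := by
    rw [intervalIntegral.integral_comp_add_right]
    have := hBper.intervalIntegral_add_eq π 0
    rw [zero_add] at this ⊢
    rw [← this, add_comm]
  have hshift' : ∫ φ in (0 : ℝ)..(2 * π), B φ = ∫ φ in (-π)..π, B φ := by
    have := hBper.intervalIntegral_add_eq 0 (-π)
    rwa [zero_add, show -π + 2 * π = π by ring] at this
  have hBi' : IntervalIntegrable (fun φ => B (φ + π)) volume 0 (2 * π) := by
    simpa using (hBi (0 + π) (2 * π + π)).comp_add_right π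
  simp only [hline]
  rw [intervalIntegral.integral_add (hBi _ _) hBi', hshift, ← two_mul, hshift',
    integral_eq_integral_polar]
  congr 1
  have hfub := integral_prod _ (integrable_polar hA hh hb (Metric.isBounded_Ioo (-π) π) (Set.Ioi 0))
  rw [intervalIntegral.integral_of_le (by linarith [Real.pi_pos]), integral_Ioc_eq_integral_Ioo, hB,
    Measure.volume_eq_prod, ← setIntegral_prod_swap, ← hfub, Measure.prod_restrict]
  refine setIntegral_congr_fun (measurableSet_Ioo.prod measurableSet_Ioi) ?_
  rintro ⟨θ, r⟩ ⟨hθ, hr⟩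
  simp only [Prod.swap]
  rw [hΦ r hr θ hθ, abs_of_pos hr]
  ring

end Polar

/-- Aliased component formula: the `2mk`-th angular Fourier coefficient of
`φ ↦ ψ(ω(φ)) G_f(ω(φ), x·ω(φ))` equals
`(1/(4π²)) ∫ e^{i x·ξ} ψ(ξ/|ξ|) e^{−2imk·arg ξ} 𝓕f(ξ) dξ`. -/
theorem aliased_component (f : SchwartzMap E2 ℂ) (ψ : E2 → ℂ)
    (hψ_smooth : ContDiffOn ℝ (⊤ : ℕ∞) ψ {x : E2 | x ≠ 0})
    (hψ_even : ∀ w : E2, ψ (-w) = ψ w)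
    (m : ℕ) (hm : 1 ≤ m) (k : ℤ) (x : E2) :
    ∫ φ in (0:ℝ)..(2 * π),
        Complex.exp (-(2 * Complex.I * (m : ℂ) * (k : ℂ) * (φ : ℂ))) *
          ψ (omega φ) * filtProj (⇑f) (omega φ) ⟪x, omega φ⟫
      = (1 / (4 * (π : ℂ) ^ 2)) *
        ∫ ξ : E2, Complex.exp (Complex.I * (⟪x, ξ⟫ : ℂ)) * ψ (‖ξ‖⁻¹ • ξ) *
          Complex.exp (-(2 * Complex.I * (m : ℂ) * (k : ℂ) * ((toC ξ).arg : ℂ))) *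
          FT (⇑f) ξ := by
  obtain ⟨g, hg⟩ := exists_schwartzMap_eq_FT f
  rw [← hg]
  set A : ℝ → ℂ := fun φ =>
    Complex.exp (-(2 * Complex.I * (m : ℂ) * (k : ℂ) * (φ : ℂ))) * ψ (omega φ) with hA
  set h : E2 → ℂ := fun ξ => Complex.exp (Complex.I * (⟪x, ξ⟫ : ℂ)) * g ξ with hh
  have hAc : Continuous A := by
    have : Continuous fun φ => ψ (omega φ) :=
      hψ_smooth.continuousOn.comp_continuous continuous_omega fun φ h0 => by
        simpa [h0] using norm_omega φ
    exact Continuous.mul (by fun_prop) this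
  have hper : Function.Periodic A π := by
    intro φ
    simp only [hA, omega_add_pi, hψ_even]
    congr 1
    refine Complex.exp_eq_exp_iff_exists_int.2 ⟨-(m * k), ?_⟩
    push_cast
    ring
  have hhc : Continuous h := by
    have := g.continuous
    fun_prop
  obtain ⟨C, hb⟩ : ∃ C, ∀ ξ, (1 + ‖ξ‖) ^ 3 * ‖h ξ‖ ≤ C := by
    have hdecay := SchwartzMap.one_add_le_sup_seminorm_apply (𝕜 := ℝ) (m := (3, 0)) le_rfl le_rfl g
    simp only [norm_iteratedFDeriv_zero] at hdecay
    refine ⟨_, fun ξ => le_of_eq_of_le ?_ (hdecay ξ)⟩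
    rw [hh, norm_mul, mul_comm Complex.I, Complex.norm_exp_ofReal_mul_I, one_mul]
  have key := integral_lines_eq_two_mul_integral hAc hper hhc hb
    (Φ := fun ξ => Complex.exp (Complex.I * (⟪x, ξ⟫ : ℂ)) * ψ (‖ξ‖⁻¹ • ξ) *
          Complex.exp (-(2 * Complex.I * (m : ℂ) * (k : ℂ) * ((toC ξ).arg : ℂ))) * g ξ) ?_
  · have hL : ∀ φ : ℝ, Complex.exp (-(2 * Complex.I * (m : ℂ) * (k : ℂ) * (φ : ℂ))) *
          ψ (omega φ) * filtProj (⇑f) (omega φ) ⟪x, omega φ⟫ =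
        (1 / (8 * (π : ℂ) ^ 2)) * (A φ * ∫ q : ℝ, (|q| : ℝ) * h (q • omega φ)) := by
      intro φ
      rw [filtProj, ← hg, mul_left_comm]
      congr 3
      ext q
      simp only [hh, inner_smul_right]
      push_cast
      rw [mul_comm (q : ℂ), ← mul_assoc Complex.I]
      ring
    simp only [hL]
    rw [intervalIntegral.integral_const_mul, key]
    ring
  · intro r hr θ hθ
    have h1 : ‖r • omega θ‖⁻¹ • r • omega θ = omega θ := by
      rw [norm_smul, norm_omega, mul_one, Real.norm_of_nonneg hr.le, inv_smul_smul₀ hr.ne']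
    have h2 : (toC (r • omega θ)).arg = θ := by
      rw [toC_smul_omega]
      exact Complex.arg_mul_cos_add_sin_mul_I hr ⟨hθ.1, hθ.2.le⟩
    simp only [h1, h2, hA, hh]
    ring
end
end

section
/- Theorem 4.2(b) (no aliasing under the Nyquist condition): Let R, B, s > 0 satisfy B < π/(s R), and let (f_h) be a semiclassically band limited family with data (R, B, s) as in the context. Let ψ ∈ C^∞(S¹) be even. For h = π/(m s) define the discrete reconstruction f_{ψ,δ,h}(x) = (2π/m) Σ_{j=1}^{m} ψ(ω_j) G_{f_h}(ω_j, x·ω_j) with ω_j = ω(π j/m), and the multiplier f_{ψ,h}(x) = (1/(4π²)) ∫_{ℝ²} e^{i x·ξ} ψ(ξ/|ξ|) 𝓕f_h(ξ) dξ. Then for every N there is C such that sup_{|x| ≤ R} |f_{ψ,δ,h}(x) − f_{ψ,h}(x)| ≤ C h^N for all admissible h. -/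
open MeasureTheory Real intervalIntegral
open scoped RealInnerProductSpace

noncomputable section

/-- A semiclassically band limited family with data `(R, B, s)`: a family
`m ↦ f_m` of Schwartz functions, `f_m` corresponding to `h = π/(m s)`, with
`supp f_h ⊆ {|x| ≤ R}`, a polynomially bounded `L²` norm `‖f_h‖_{L²} ≤ C h^{−M}`,
and, for every `B′ > B` and every `N`, `|𝓕f_h(ξ/h)| ≤ C_N h^N (1+|ξ|)^{−N}`
for `|ξ| ≥ B′`. -/
def SCBandLimited (R B s : ℝ) (f : ℕ → SchwartzMap E2 ℂ) : Prop :=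
  (∀ m : ℕ, 1 ≤ m → ∀ x : E2, R < ‖x‖ → f m x = 0) ∧
  (∃ C : ℝ, ∃ M : ℕ, ∀ m : ℕ, 1 ≤ m →
    Real.sqrt (∫ x : E2, ‖f m x‖ ^ 2) ≤ C / (π / ((m : ℝ) * s)) ^ M) ∧
  (∀ B' : ℝ, B < B' → ∀ N : ℕ, ∃ C : ℝ, ∀ m : ℕ, 1 ≤ m → ∀ ξ : E2, B' ≤ ‖ξ‖ →
    ‖FT (⇑(f m)) ((π / ((m : ℝ) * s))⁻¹ • ξ)‖
      ≤ C * (π / ((m : ℝ) * s)) ^ N / (1 + ‖ξ‖) ^ N)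

/-- The domain on which `phase` has no stationary point. -/
def phaseDomain : Set ((ℝ × ℝ) × ℝ) := {p | p.1.1 ^ 2 + p.1.2 ^ 2 < 1}

/-- The phase `u₁ cos φ + u₂ sin φ - φ` of a normalized Fourier coefficient. -/
def phase (u : ℝ × ℝ) (φ : ℝ) : ℝ := u.1 * Real.cos φ + u.2 * Real.sin φ - φ

/-- The `φ`-derivative of `phase`. -/
def phaseDeriv (p : (ℝ × ℝ) × ℝ) : ℝ := -p.1.1 * Real.sin p.2 + p.1.2 * Real.cos p.2 - 1

lemma isOpen_phaseDomain : IsOpen phaseDomain :=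
  isOpen_lt (by fun_prop) continuous_const

lemma abs_mul_cos_add_mul_sin_sq_le (a b φ : ℝ) :
    (a * Real.cos φ + b * Real.sin φ) ^ 2 ≤ a ^ 2 + b ^ 2 := by
  nlinarith [sq_nonneg (a * Real.sin φ - b * Real.cos φ), Real.sin_sq_add_cos_sq φ]

lemma phaseDeriv_ne_zero {p : (ℝ × ℝ) × ℝ} (hp : p ∈ phaseDomain) : phaseDeriv p ≠ 0 := by
  intro h
  have h1 := abs_mul_cos_add_mul_sin_sq_le p.1.2 (-p.1.1) p.2
  have h2 : p.1.1 ^ 2 + p.1.2 ^ 2 < 1 := hp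
  have h3 : p.1.2 * Real.cos p.2 + -p.1.1 * Real.sin p.2 = 1 := by
    unfold phaseDeriv at h; linarith
  rw [h3] at h1
  linarith

lemma hasDerivAt_phase (u : ℝ × ℝ) (φ : ℝ) : HasDerivAt (phase u) (phaseDeriv (u, φ)) φ := by
  have := (((Real.hasDerivAt_cos φ).const_mul u.1).add
    ((Real.hasDerivAt_sin φ).const_mul u.2)).sub (hasDerivAt_id φ)
  convert! this using 1
  simp [phaseDeriv]

lemma contDiff_phaseDeriv : ContDiff ℝ (⊤ : ℕ∞) phaseDeriv := by
  unfold phaseDeriv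
  fun_prop

lemma continuous_phase (u : ℝ × ℝ) : Continuous (phase u) := by
  unfold phase
  fun_prop

/-- Non-stationary phase, uniformly in the parameters of the phase. -/
lemma exists_oscillatory_integral_le {θ : ℝ} (hθ0 : 0 ≤ θ) (hθ : θ < 1) (N : ℕ) :
    ∀ b : (ℝ × ℝ) × ℝ → ℂ, ContDiffOn ℝ (⊤ : ℕ∞) b phaseDomain →
      (∀ u φ, b (u, φ + 2 * π) = b (u, φ)) →
      ∃ C : ℝ, 0 ≤ C ∧ ∀ n : ℤ, n ≠ 0 → ∀ u : ℝ × ℝ, u.1 ^ 2 + u.2 ^ 2 ≤ θ ^ 2 →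
        ‖∫ φ in -π..π, b (u, φ) * Complex.exp (Complex.I * n * phase u φ)‖
          ≤ C / |(n : ℝ)| ^ N := by
  have hmem : ∀ u : ℝ × ℝ, u.1 ^ 2 + u.2 ^ 2 ≤ θ ^ 2 → ∀ φ : ℝ, (u, φ) ∈ phaseDomain := by
    intro u hu φ
    have : u.1 ^ 2 + u.2 ^ 2 < 1 := by nlinarith
    exact this
  have hpi := Real.pi_pos
  induction N with
  | zero =>
    intro b hb _
    have hcont : Continuous fun u : ℝ × ℝ => u.1 ^ 2 + u.2 ^ 2 := by fun_prop
    have hK : IsCompact ({u : ℝ × ℝ | u.1 ^ 2 + u.2 ^ 2 ≤ θ ^ 2} ×ˢ Set.Icc (-π) π) := by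
      refine IsCompact.prod ?_ isCompact_Icc
      refine ((isCompact_Icc (a := -θ) (b := θ)).prod
        (isCompact_Icc (a := -θ) (b := θ))).of_isClosed_subset
        (isClosed_le hcont continuous_const) ?_
      intro u hu
      have hu' : u.1 ^ 2 + u.2 ^ 2 ≤ θ ^ 2 := hu
      exact ⟨abs_le.1 (abs_le_of_sq_le_sq (by nlinarith) hθ0),
        abs_le.1 (abs_le_of_sq_le_sq (by nlinarith) hθ0)⟩
    obtain ⟨C, hC⟩ := hK.exists_bound_of_continuousOn (f := b)
      (hb.continuousOn.mono fun p hp => hmem p.1 hp.1 p.2)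
    refine ⟨|C| * (2 * π), by positivity, fun n _ u hu => ?_⟩
    have := intervalIntegral.norm_integral_le_of_norm_le_const (a := -π) (b := π) (C := |C|)
      (f := fun φ => b (u, φ) * Complex.exp (Complex.I * n * phase u φ)) ?_
    · refine this.trans_eq ?_
      rw [show π - -π = 2 * π by ring, abs_of_pos (by positivity : (0 : ℝ) < 2 * π),
        pow_zero, div_one]
    · intro φ hφ
      rw [Set.uIoc_of_le (by linarith)] at hφ
      have he : ‖Complex.exp (Complex.I * n * phase u φ)‖ = 1 := by
        have : Complex.I * n * phase u φ = ((n * phase u φ : ℝ) : ℂ) * Complex.I := by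
          push_cast; ring
        rw [this, Complex.norm_exp_ofReal_mul_I]
      rw [norm_mul, he, mul_one]
      exact (hC (u, φ) ⟨hu, hφ.1.le, hφ.2⟩).trans (le_abs_self C)
  | succ N ih =>
    intro b hb hper
    set c : (ℝ × ℝ) × ℝ → ℂ := fun p => (phaseDeriv p)⁻¹ • b p with hc
    have hcs : ContDiffOn ℝ (⊤ : ℕ∞) c phaseDomain :=
      (contDiff_phaseDeriv.contDiffOn.inv fun p hp => phaseDeriv_ne_zero hp).smul hb
    have hcper : ∀ u φ, c (u, φ + 2 * π) = c (u, φ) := by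
      intro u φ
      simp only [hc, phaseDeriv, hper, Real.sin_add_two_pi, Real.cos_add_two_pi]
    set db : (ℝ × ℝ) × ℝ → ℂ := fun p => fderiv ℝ c p (0, 1) with hdb
    have hdb_smooth : ContDiffOn ℝ (⊤ : ℕ∞) db phaseDomain :=
      (hcs.fderiv_of_isOpen isOpen_phaseDomain (by simp)).clm_apply contDiffOn_const
    have hdb_per : ∀ u φ, db (u, φ + 2 * π) = db (u, φ) := by
      intro u φ
      have h1 : (fun p : (ℝ × ℝ) × ℝ => c (p + (0, 2 * π))) = c := by
        ext p
        rw [← hcper p.1 p.2]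
        congr 1
        simp [Prod.ext_iff]
      have h2 := fderiv_comp_add_right (𝕜 := ℝ) (f := c) (x := (u, φ)) ((0, 2 * π))
      rw [h1] at h2
      simp only [hdb, h2]
      simp
    obtain ⟨C, hC0, hC⟩ := ih db hdb_smooth hdb_per
    refine ⟨C, hC0, fun n hn u hu => ?_⟩
    have hnC : (Complex.I * n : ℂ) ≠ 0 :=
      mul_ne_zero Complex.I_ne_zero (by exact_mod_cast hn)
    have hcd : ∀ φ : ℝ, HasDerivAt (fun φ : ℝ => c (u, φ)) (db (u, φ)) φ := by
      intro φ
      have hd : HasFDerivAt c (fderiv ℝ c (u, φ)) (u, φ) :=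
        ((hcs.contDiffAt (isOpen_phaseDomain.mem_nhds (hmem u hu φ))).differentiableAt
          (by simp)).hasFDerivAt
      exact hd.comp_hasDerivAt φ ((hasDerivAt_const φ u).prodMk (hasDerivAt_id φ))
    have hed : ∀ φ : ℝ, HasDerivAt (fun φ : ℝ => Complex.exp (Complex.I * n * phase u φ))
        (Complex.exp (Complex.I * n * phase u φ) * (Complex.I * n * phaseDeriv (u, φ))) φ :=
      fun φ => (((hasDerivAt_phase u φ).ofReal_comp).const_mul (Complex.I * n)).cexp
    have hbc : Continuous fun φ => db (u, φ) := by
      rw [← continuousOn_univ]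
      exact hdb_smooth.continuousOn.comp (by fun_prop) fun φ _ => hmem u hu φ
    have hphc : Continuous (phase u) := continuous_phase u
    have hpdc : Continuous phaseDeriv := contDiff_phaseDeriv.continuous
    have hparts := intervalIntegral.integral_mul_deriv_eq_deriv_mul (a := -π) (b := π)
      (fun φ _ => hcd φ) (fun φ _ => hed φ) (hbc.intervalIntegrable _ _)
      (Continuous.intervalIntegrable (by fun_prop) _ _)
    have hend : c (u, π) * Complex.exp (Complex.I * n * phase u π)
        - c (u, -π) * Complex.exp (Complex.I * n * phase u (-π)) = 0 := by
      have h1 : c (u, π) = c (u, -π) := by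
        rw [← hcper u (-π)]; congr 2; ring
      have h2 : Complex.exp (Complex.I * n * phase u (-π))
          = Complex.exp (Complex.I * n * phase u π) := by
        have : Complex.I * n * phase u (-π)
            = Complex.I * n * phase u π + n * (2 * π * Complex.I) := by
          simp only [phase, Real.cos_neg, Real.sin_neg, Real.sin_pi]
          push_cast; ring
        rw [this, Complex.exp_add, Complex.exp_int_mul_two_pi_mul_I, mul_one]
      rw [h1, h2, sub_self]
    rw [hend, zero_sub] at hparts
    have heq : ∫ φ in -π..π, b (u, φ) * Complex.exp (Complex.I * n * phase u φ)
        = (Complex.I * n)⁻¹ *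
          (-∫ φ in -π..π, db (u, φ) * Complex.exp (Complex.I * n * phase u φ)) := by
      rw [← hparts, ← intervalIntegral.integral_const_mul]
      refine intervalIntegral.integral_congr fun φ _ => ?_
      have hne : (phaseDeriv (u, φ) : ℂ) ≠ 0 := by
        exact_mod_cast phaseDeriv_ne_zero (hmem u hu φ)
      simp only [hc, Complex.real_smul, Complex.ofReal_inv]
      have hn' : (n : ℂ) ≠ 0 := by exact_mod_cast hn
      field_simp
    rw [heq, norm_mul, norm_neg, norm_inv, norm_mul, Complex.norm_I, one_mul, Complex.norm_intCast]
    have hn0 : 0 < |(n : ℝ)| := abs_pos.2 (by exact_mod_cast hn)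
    calc |(n : ℝ)|⁻¹ * _ ≤ |(n : ℝ)|⁻¹ * (C / |(n : ℝ)| ^ N) :=
          mul_le_mul_of_nonneg_left (hC n hn u hu) (by positivity)
      _ = C / |(n : ℝ)| ^ (N + 1) := by field_simp; ring

/-- The error of the trapezoidal rule with nodes `π j / m`, `1 ≤ j ≤ 2 m`, for the integral of a
`2π`-periodic function over a period. -/
def trapErr (m : ℕ) (g : ℝ → ℂ) : ℂ :=
  (π / m : ℂ) * ∑ j ∈ Finset.Icc 1 (2 * m), g (π * (j : ℝ) / m) - ∫ φ in -π..π, g φ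

lemma sum_exp_nodes_eq_zero {m : ℕ} (hm : 1 ≤ m) {n : ℤ} (hn : ¬ (2 * m : ℤ) ∣ n) :
    ∑ j ∈ Finset.Icc 1 (2 * m), Complex.exp (Complex.I * n * ((π * (j : ℝ) / m : ℝ) : ℂ)) = 0 := by
  have hm0 : (m : ℂ) ≠ 0 := by exact_mod_cast (by omega : m ≠ 0)
  have hpi : (π : ℂ) ≠ 0 := by exact_mod_cast Real.pi_ne_zero
  set z := Complex.exp (Complex.I * n * π / m) with hz
  have hpow : ∀ j : ℕ, Complex.exp (Complex.I * n * ((π * (j : ℝ) / m : ℝ) : ℂ)) = z ^ j := by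
    intro j
    rw [hz, ← Complex.exp_nat_mul]
    congr 1
    push_cast
    ring
  have hz1 : z ≠ 1 := by
    intro h
    obtain ⟨k, hk⟩ := Complex.exp_eq_one_iff.1 h
    apply hn
    refine ⟨k, ?_⟩
    field_simp at hk
    have h2 : (n : ℂ) * (Complex.I * π) = (2 * m * k) * (Complex.I * π) := by
      linear_combination (Complex.I * π) * hk
    exact_mod_cast mul_right_cancel₀ (mul_ne_zero Complex.I_ne_zero hpi) h2
  have hzM : z ^ (2 * m) = 1 := by
    rw [hz, ← Complex.exp_nat_mul, Complex.exp_eq_one_iff]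
    refine ⟨n, ?_⟩
    push_cast
    field_simp
  simp_rw [hpow]
  have hsum : ∑ j ∈ Finset.Icc 1 (2 * m), z ^ j = z * ∑ j ∈ Finset.range (2 * m), z ^ j := by
    rw [Finset.range_eq_Ico, Finset.mul_sum]
    simp_rw [← pow_succ']
    rw [Finset.sum_Ico_add' (fun j => z ^ j) 0 (2 * m) 1]
    rfl
  rw [hsum, geom_sum_eq hz1, hzM]
  simp

/-- Aliasing estimate for the trapezoidal rule: only the Fourier coefficients of order at least
the number of nodes contribute to the error. -/
lemma norm_trapErr_le {m : ℕ} (hm : 1 ≤ m) {g : ℝ → ℂ} (hg : Continuous g)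
    (hper : Function.Periodic g (2 * π)) {K : ℝ} (hK : 0 ≤ K)
    (hcoeff : ∀ n : ℤ, 2 * (m : ℝ) ≤ |(n : ℝ)| →
      ‖∫ φ in -π..π, g φ * Complex.exp (-(Complex.I * n * φ))‖ ≤ K * (1 / (n : ℝ) ^ 2)) :
    ‖trapErr m g‖ ≤ K * ∑' n : ℤ, 1 / (n : ℝ) ^ 2 := by
  have hpi := Real.pi_pos
  have hmR : (0 : ℝ) < m := by exact_mod_cast hm
  have : Fact (0 < 2 * π) := ⟨by positivity⟩
  let G : C(AddCircle (2 * π), ℂ) := ⟨hper.lift, continuous_coinduced_dom.mpr (by exact hg)⟩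
  have hG : ∀ t : ℝ, G (t : AddCircle (2 * π)) = g t := fun t => hper.lift_coe t
  have hc : ∀ n : ℤ, fourierCoeff G n
      = (1 / (2 * π) : ℂ) * ∫ φ in -π..π, g φ * Complex.exp (-(Complex.I * n * φ)) := by
    intro n
    rw [fourierCoeff_eq_intervalIntegral _ n (-π), show -π + 2 * π = π by ring]
    rw [Complex.real_smul]
    push_cast
    congr 1
    refine intervalIntegral.integral_congr fun φ _ => ?_
    simp only [hG, fourier_coe_apply, smul_eq_mul]
    rw [mul_comm]
    congr 2
    push_cast
    have : (π : ℂ) ≠ 0 := by exact_mod_cast hpi.ne'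
    field_simp
  have hcn : ∀ n : ℤ, 2 * (m : ℝ) ≤ |(n : ℝ)| →
      2 * π * ‖fourierCoeff G n‖ ≤ K * (1 / (n : ℝ) ^ 2) := by
    intro n hn
    refine le_trans (le_of_eq ?_) (hcoeff n hn)
    rw [hc, norm_mul]
    simp only [norm_div, norm_mul, norm_one, Complex.norm_real, Complex.norm_ofNat, Real.norm_eq_abs,
      abs_of_pos hpi]
    field_simp
  have hsq : Summable fun n : ℤ => 1 / (n : ℝ) ^ 2 := Real.summable_one_div_int_pow.2 one_lt_two
  have hsum : Summable (fourierCoeff G) := by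
    have hfin : {n : ℤ | ¬ 2 * (m : ℝ) ≤ |(n : ℝ)|}.Finite := by
      refine (Set.finite_Icc (-(2 * m) : ℤ) (2 * m)).subset fun n hn => ?_
      have h1 : |(n : ℝ)| < 2 * m := not_le.1 hn
      have h2 := abs_lt.1 h1
      exact ⟨by exact_mod_cast h2.1.le, by exact_mod_cast h2.2.le⟩
    refine Summable.of_norm_bounded_eventually (g := fun n : ℤ => K / (2 * π) * (1 / (n : ℝ) ^ 2))
      (hsq.mul_left _) ?_
    refine Filter.eventually_cofinite.2 (hfin.subset fun n hn hn' => hn ?_)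
    have := hcn n hn'
    rw [div_mul_eq_mul_div, le_div_iff₀ (by positivity)]
    linarith
  set T : ℤ → ℂ := fun n => (π / m : ℂ) * ∑ j ∈ Finset.Icc 1 (2 * m),
    fourierCoeff G n * Complex.exp (Complex.I * n * ((π * (j : ℝ) / m : ℝ) : ℂ)) with hT
  have hTsum : HasSum T ((π / m : ℂ) * ∑ j ∈ Finset.Icc 1 (2 * m), g (π * (j : ℝ) / m)) := by
    refine HasSum.mul_left _ (hasSum_sum fun j _ => ?_)
    have := has_pointwise_sum_fourier_series_of_summable hsum
      ((π * (j : ℝ) / m : ℝ) : AddCircle (2 * π))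
    rw [hG] at this
    convert! this using 2 with n
    rw [fourier_coe_apply, smul_eq_mul]
    congr 2
    push_cast
    have : (π : ℂ) ≠ 0 := by exact_mod_cast hpi.ne'
    field_simp
  have hT0 : T 0 = ∫ φ in -π..π, g φ := by
    have : (π : ℂ) ≠ 0 := by exact_mod_cast hpi.ne'
    have hm0 : (m : ℂ) ≠ 0 := by exact_mod_cast hmR.ne'
    simp [hT, hc]
    field_simp
  have hE : HasSum (fun n : ℤ => if n = 0 then 0 else T n) (trapErr m g) := by
    have h1 := hTsum.sub (hasSum_ite_eq (0 : ℤ) (T 0))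
    convert! h1 using 1
    · ext n
      by_cases hn : n = 0 <;> simp [hn]
    · rw [hT0, trapErr]
  rw [← hE.tsum_eq]
  refine tsum_of_norm_bounded (hsq.hasSum.mul_left K) fun n => ?_
  by_cases hn0 : n = 0
  · simp [hn0]
  rw [if_neg hn0]
  by_cases hdiv : (2 * m : ℤ) ∣ n
  · have hle : 2 * (m : ℝ) ≤ |(n : ℝ)| := by
      have := Int.le_of_dvd (abs_pos.2 hn0) ((dvd_abs _ _).2 hdiv)
      exact_mod_cast this
    refine le_trans ?_ (hcn n hle)
    have hb : ‖∑ j ∈ Finset.Icc 1 (2 * m),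
        fourierCoeff G n * Complex.exp (Complex.I * n * ((π * (j : ℝ) / m : ℝ) : ℂ))‖
          ≤ 2 * m * ‖fourierCoeff G n‖ := by
      refine (norm_sum_le_of_le (f := fun j : ℕ => fourierCoeff G n *
        Complex.exp (Complex.I * n * ((π * (j : ℝ) / m : ℝ) : ℂ)))
        (n := fun _ => ‖fourierCoeff G n‖) _ fun j _ => ?_).trans_eq (by simp)
      have : Complex.I * n * ((π * (j : ℝ) / m : ℝ) : ℂ)
          = ((n * (π * (j : ℝ) / m) : ℝ) : ℂ) * Complex.I := by push_cast; ring
      rw [norm_mul, this, Complex.norm_exp_ofReal_mul_I, mul_one]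
    have hpm : ‖(π / m : ℂ)‖ = π / m := by
      simp [abs_of_pos hpi]
    rw [hT, norm_mul, hpm]
    refine (mul_le_mul_of_nonneg_left hb (by positivity)).trans_eq ?_
    field_simp
  · have : T n = 0 := by
      simp only [hT, ← Finset.mul_sum, sum_exp_nodes_eq_zero hm hdiv, mul_zero]
    rw [this, norm_zero]
    positivity

/-- The trapezoidal error is rapidly decaying for a fixed smooth amplitude times an exponential
whose frequency stays below the Nyquist rate. -/
lemma exists_norm_trapErr_exp_le {θ : ℝ} (hθ0 : 0 ≤ θ) (hθ : θ < 1) {a : ℝ → ℂ}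
    (ha : ContDiff ℝ (⊤ : ℕ∞) a) (hper : Function.Periodic a (2 * π)) (N : ℕ) :
    ∃ C : ℝ, 0 ≤ C ∧ ∀ m : ℕ, 1 ≤ m → ∀ α β : ℝ, α ^ 2 + β ^ 2 ≤ (2 * θ * m) ^ 2 →
      ‖trapErr m fun φ => a φ *
        Complex.exp (Complex.I * ((α * Real.cos φ + β * Real.sin φ : ℝ) : ℂ))‖
        ≤ C / (m : ℝ) ^ N := by
  obtain ⟨C, hC0, hC⟩ := exists_oscillatory_integral_le hθ0 hθ (N + 2) (fun p => a p.2)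
    (ha.comp contDiff_snd).contDiffOn (fun u φ => hper φ)
  refine ⟨C * ∑' n : ℤ, 1 / (n : ℝ) ^ 2, mul_nonneg hC0 (tsum_nonneg fun n => by positivity),
    fun m hm α β hαβ => ?_⟩
  have hmR : (0 : ℝ) < m := by exact_mod_cast hm
  rw [mul_div_right_comm]
  have hac := ha.continuous
  refine norm_trapErr_le hm (by fun_prop) ?_ (by positivity) fun n hn => ?_
  · intro φ
    simp only [hper φ, Real.cos_add_two_pi, Real.sin_add_two_pi]
  have hnpos : 0 < |(n : ℝ)| := by linarith
  have hnR : (n : ℝ) ≠ 0 := abs_pos.1 hnpos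
  have hn0 : n ≠ 0 := by exact_mod_cast hnR
  have hnC : (n : ℂ) ≠ 0 := by exact_mod_cast hn0
  have h1 := hC n hn0 (α / n, β / n) (by
    simp only [div_pow, ← add_div]
    rw [div_le_iff₀ (by positivity)]
    refine hαβ.trans ?_
    rw [← sq_abs (n : ℝ), ← mul_pow]
    exact pow_le_pow_left₀ (by positivity) (by nlinarith) 2)
  have heq : ∀ φ : ℝ, a φ * Complex.exp (Complex.I * ((α * Real.cos φ + β * Real.sin φ : ℝ) : ℂ))
      * Complex.exp (-(Complex.I * n * φ))
      = a φ * Complex.exp (Complex.I * n * phase (α / n, β / n) φ) := by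
    intro φ
    rw [mul_assoc, ← Complex.exp_add]
    congr 2
    simp only [phase]
    push_cast
    field_simp
    ring
  simp_rw [heq]
  refine h1.trans ?_
  rw [div_mul_div_comm, mul_one, ← sq_abs (n : ℝ), pow_add]
  have : (m : ℝ) ^ N ≤ |(n : ℝ)| ^ N := pow_le_pow_left₀ hmR.le (by linarith) N
  gcongr

lemma norm_trapErr_le_of_norm_le {m : ℕ} (hm : 1 ≤ m) {g : ℝ → ℂ} {S : ℝ}
    (hg : ∀ φ, ‖g φ‖ ≤ S) : ‖trapErr m g‖ ≤ 4 * π * S := by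
  have hpi := Real.pi_pos
  have hmR : (0 : ℝ) < m := by exact_mod_cast hm
  have h1 : ‖(π / m : ℂ) * ∑ j ∈ Finset.Icc 1 (2 * m), g (π * (j : ℝ) / m)‖ ≤ 2 * π * S := by
    have hb : ‖∑ j ∈ Finset.Icc 1 (2 * m), g (π * (j : ℝ) / m)‖ ≤ 2 * m * S :=
      (norm_sum_le_of_le _ fun j _ => hg _).trans_eq (by simp)
    have hpm : ‖(π / m : ℂ)‖ = π / m := by
      simp [abs_of_pos hpi]
    rw [norm_mul, hpm]
    refine (mul_le_mul_of_nonneg_left hb (by positivity)).trans_eq ?_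
    field_simp
  have h2 : ‖∫ φ in -π..π, g φ‖ ≤ S * (2 * π) := by
    refine (intervalIntegral.norm_integral_le_of_norm_le_const fun φ _ => hg φ).trans_eq ?_
    rw [show π - -π = 2 * π by ring, abs_of_pos (by positivity)]
  exact (norm_sub_le _ _).trans (by linarith)

lemma trapErr_const_mul (m : ℕ) (c : ℂ) (g : ℝ → ℂ) :
    trapErr m (fun φ => c * g φ) = c * trapErr m g := by
  simp only [trapErr, ← Finset.mul_sum, intervalIntegral.integral_const_mul]
  ring

/-- The trapezoidal error commutes with integration over a parameter. -/
lemma trapErr_integral {α : Type*} [MeasurableSpace α] {μ : Measure α} [SFinite μ] (m : ℕ)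
    {g : α → ℝ → ℂ} (hg : ∀ φ, Integrable (fun y => g y φ) μ)
    (hg2 : Integrable (Function.uncurry g) (μ.prod (volume.restrict (Set.Ioc (-π) π)))) :
    trapErr m (fun φ => ∫ y, g y φ ∂μ) = ∫ y, trapErr m (g y) ∂μ := by
  have hpi : -π ≤ π := by linarith [Real.pi_pos]
  simp only [trapErr, intervalIntegral.integral_of_le hpi]
  rw [MeasureTheory.integral_sub, MeasureTheory.integral_const_mul,
    MeasureTheory.integral_finsetSum _ fun j _ => hg _,
    integral_integral_swap hg2]
  · exact (integrable_finsetSum _ fun j _ => hg _).const_mul _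
  · exact hg2.integral_prod_left

lemma omega_zero (φ : ℝ) : omega φ 0 = Real.cos φ := rfl

lemma omega_one (φ : ℝ) : omega φ 1 = Real.sin φ := rfl

lemma inner_omega (x : E2) (φ : ℝ) : ⟪x, omega φ⟫ = x 0 * Real.cos φ + x 1 * Real.sin φ := by
  simp [PiLp.inner_apply, Fin.sum_univ_two, omega_zero, omega_one, mul_comm]

lemma omega_add_two_pi (φ : ℝ) : omega (φ + 2 * π) = omega φ := by
  simp [omega]

lemma contDiff_omega : ContDiff ℝ (⊤ : ℕ∞) omega := by
  rw [contDiff_euclidean]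
  intro i
  fin_cases i
  · exact Real.contDiff_cos
  · exact Real.contDiff_sin

lemma norm_smul_omega (r φ : ℝ) : ‖r • omega φ‖ = |r| := by
  rw [norm_smul, norm_omega, mul_one, Real.norm_eq_abs]

/-- Integration over the plane in polar coordinates. -/
lemma integral_polar (H : E2 → ℂ) :
    ∫ ξ, H ξ = ∫ p in Set.Ioi (0 : ℝ) ×ˢ Set.Ioo (-π) π, (p.1 : ℂ) * H (p.1 • omega p.2) := by
  have h1 := (Complex.orthonormalBasisOneI.repr.measurePreserving).integral_comp
    (Complex.orthonormalBasisOneI.repr.toHomeomorph.measurableEmbedding) H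
  rw [← h1]
  have h2 := Complex.integral_comp_polarCoord_symm
    (fun z => H (Complex.orthonormalBasisOneI.repr z))
  rw [← h2, polarCoord_target]
  refine integral_congr_ae (Filter.Eventually.of_forall fun p => ?_)
  have : Complex.orthonormalBasisOneI.repr (Complex.polarCoord.symm p) = p.1 • omega p.2 := by
    ext i
    fin_cases i <;>
      simp [Complex.polarCoord_symm_apply, omega, -Complex.ofReal_cos, -Complex.ofReal_sin]
  simp only [this, Complex.real_smul]

open scoped FourierTransform in
lemma FT_eq_fourier (f : SchwartzMap E2 ℂ) (ξ : E2) : FT f ξ = 𝓕 f ((2 * π)⁻¹ • ξ) := by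
  have hpi : (π : ℂ) ≠ 0 := by exact_mod_cast Real.pi_ne_zero
  rw [SchwartzMap.fourier_coe, Real.fourier_eq', FT]
  refine integral_congr_ae (Filter.Eventually.of_forall fun y => ?_)
  simp only [inner_smul_right, smul_eq_mul]
  congr 2
  push_cast
  field_simp

lemma continuous_FT (f : SchwartzMap E2 ℂ) : Continuous (FT f) := by
  rw [funext (FT_eq_fourier f)]
  fun_prop

open scoped FourierTransform in
lemma exists_norm_FT_le (f : SchwartzMap E2 ℂ) (k : ℕ) :
    ∃ C : ℝ, 0 ≤ C ∧ ∀ ξ, ‖FT f ξ‖ ≤ C / (1 + ‖ξ‖) ^ k := by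
  have hpi := Real.pi_gt_three
  set C := 2 ^ k * (Finset.Iic ((k, 0) : ℕ × ℕ)).sup
    (fun m => SchwartzMap.seminorm ℂ m.1 m.2) (𝓕 f) with hC
  have hbound : ∀ η, (1 + ‖η‖) ^ k * ‖𝓕 f η‖ ≤ C := fun η => by
    simpa using SchwartzMap.one_add_le_sup_seminorm_apply (𝕜 := ℂ) (m := (k, 0)) le_rfl le_rfl
      (𝓕 f) η
  have hC0 : 0 ≤ C := le_trans (by positivity) (hbound 0)
  refine ⟨(2 * π) ^ k * C, by positivity, fun ξ => ?_⟩
  rw [FT_eq_fourier, le_div_iff₀ (by positivity)]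
  set η : E2 := (2 * π)⁻¹ • ξ with hη
  have hnorm : ‖ξ‖ = 2 * π * ‖η‖ := by
    rw [hη, norm_smul, Real.norm_eq_abs, abs_of_pos (by positivity)]
    field_simp
  have h1 : (1 + ‖ξ‖) ^ k ≤ (2 * π) ^ k * (1 + ‖η‖) ^ k := by
    rw [← mul_pow]
    exact pow_le_pow_left₀ (by positivity) (by rw [hnorm]; linarith) k
  calc ‖𝓕 f η‖ * (1 + ‖ξ‖) ^ k ≤ ‖𝓕 f η‖ * ((2 * π) ^ k * (1 + ‖η‖) ^ k) := by gcongr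
    _ = (2 * π) ^ k * ((1 + ‖η‖) ^ k * ‖𝓕 f η‖) := by ring
    _ ≤ (2 * π) ^ k * C := by gcongr; exact hbound η

lemma integrable_one_add_abs_sq_inv : Integrable fun r : ℝ => ((1 + |r|) ^ 2)⁻¹ := by
  have := integrable_one_add_norm (E := ℝ) (μ := volume) (r := 2) (by simp)
  refine this.congr (Filter.Eventually.of_forall fun r => ?_)
  simp only
  rw [Real.rpow_neg (by positivity), Real.norm_eq_abs]
  norm_cast

/-- The integrand of the multiplier in polar coordinates. -/
def polarKernel (f : SchwartzMap E2 ℂ) (ψ : E2 → ℂ) (x : E2) (r φ : ℝ) : ℂ :=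
  r * (Complex.exp (Complex.I * (⟪x, r • omega φ⟫ : ℝ)) * ψ (omega φ) * FT f (r • omega φ))

lemma norm_exp_I_mul (t : ℝ) : ‖Complex.exp (Complex.I * t)‖ = 1 := by
  rw [mul_comm, Complex.norm_exp_ofReal_mul_I]

lemma norm_polarKernel (f : SchwartzMap E2 ℂ) (ψ : E2 → ℂ) (x : E2) (r φ : ℝ) :
    ‖polarKernel f ψ x r φ‖ = |r| * (‖ψ (omega φ)‖ * ‖FT f (r • omega φ)‖) := by
  rw [polarKernel, norm_mul, norm_mul, norm_mul, norm_exp_I_mul, one_mul, Complex.norm_real,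
    Real.norm_eq_abs]

lemma mul_div_one_add_pow_three_le {t C : ℝ} (ht : 0 ≤ t) (hC : 0 ≤ C) :
    t * (C / (1 + t) ^ 3) ≤ C * ((1 + t) ^ 2)⁻¹ := by
  have h : t * (C / (1 + t) ^ 3) = C * ((1 + t) ^ 2)⁻¹ * (t / (1 + t)) := by
    field_simp
  rw [h]
  exact mul_le_of_le_one_right (by positivity) ((div_le_one (by positivity)).2 (by linarith))

lemma exists_norm_polarKernel_le (f : SchwartzMap E2 ℂ) {ψ : E2 → ℂ}
    (hψ : ∃ S, ∀ φ, ‖ψ (omega φ)‖ ≤ S) (x : E2) :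
    ∃ C : ℝ, ∀ r φ, ‖polarKernel f ψ x r φ‖ ≤ C * ((1 + |r|) ^ 2)⁻¹ := by
  obtain ⟨S, hS⟩ := hψ
  obtain ⟨C, hC0, hC⟩ := exists_norm_FT_le f 3
  have hS0 : 0 ≤ S := (norm_nonneg _).trans (hS 0)
  refine ⟨S * C, fun r φ => ?_⟩
  rw [norm_polarKernel]
  refine le_trans ?_ (mul_div_one_add_pow_three_le (abs_nonneg r) (mul_nonneg hS0 hC0))
  have h := hC (r • omega φ)
  rw [norm_smul_omega] at h
  rw [mul_div_assoc]
  gcongr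
  exact hS φ

lemma continuous_polarKernel (f : SchwartzMap E2 ℂ) {ψ : E2 → ℂ}
    (hψ : Continuous fun φ => ψ (omega φ)) (x : E2) :
    Continuous (Function.uncurry (polarKernel f ψ x)) := by
  have h1 := continuous_FT f
  have h2 := continuous_omega
  have h3 : Continuous fun p : ℝ × ℝ => ψ (omega p.2) := hψ.comp continuous_snd
  have h4 : Continuous fun p : ℝ × ℝ => p.1 • omega p.2 :=
    continuous_fst.smul (h2.comp continuous_snd)
  have h5 : Continuous fun p : ℝ × ℝ =>
      Complex.exp (Complex.I * ((⟪x, p.1 • omega p.2⟫ : ℝ) : ℂ)) :=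
    Complex.continuous_exp.comp
      (continuous_const.mul (Complex.continuous_ofReal.comp (continuous_const.inner h4)))
  exact (Complex.continuous_ofReal.comp continuous_fst).mul ((h5.mul h3).mul (h1.comp h4))

lemma integrable_polarKernel (f : SchwartzMap E2 ℂ) {ψ : E2 → ℂ}
    (hψc : Continuous fun φ => ψ (omega φ)) (hψ : ∃ S, ∀ φ, ‖ψ (omega φ)‖ ≤ S) (x : E2) (φ : ℝ) :
    Integrable fun r => polarKernel f ψ x r φ := by
  obtain ⟨C, hC⟩ := exists_norm_polarKernel_le f hψ x
  have hc : Continuous fun r => polarKernel f ψ x r φ :=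
    (continuous_polarKernel f hψc x).comp (by fun_prop : Continuous fun r : ℝ => (r, φ))
  exact (integrable_one_add_abs_sq_inv.const_mul C).mono' hc.aestronglyMeasurable
    (Filter.Eventually.of_forall fun r => hC r φ)

lemma integrable_uncurry_polarKernel (f : SchwartzMap E2 ℂ) {ψ : E2 → ℂ}
    (hψc : Continuous fun φ => ψ (omega φ)) (hψ : ∃ S, ∀ φ, ‖ψ (omega φ)‖ ≤ S) (x : E2) :
    Integrable (Function.uncurry (polarKernel f ψ x))
      ((volume.restrict (Set.Ioi 0)).prod (volume.restrict (Set.Ioc (-π) π))) := by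
  obtain ⟨C, hC⟩ := exists_norm_polarKernel_le f hψ x
  have h1 : Integrable (fun p : ℝ × ℝ => (C * ((1 + |p.1|) ^ 2)⁻¹) * 1)
      ((volume.restrict (Set.Ioi (0 : ℝ))).prod (volume.restrict (Set.Ioc (-π) π))) :=
    Integrable.mul_prod ((integrable_one_add_abs_sq_inv.const_mul C).restrict)
      (integrable_const (1 : ℝ))
  refine h1.mono' (continuous_polarKernel f hψc x).aestronglyMeasurable
    (Filter.Eventually.of_forall fun p => ?_)
  rw [mul_one]
  exact hC p.1 p.2

/-- The filtered projection as a sum of two half-line integrals of the polar kernel. -/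
lemma mul_filtProj_eq (f : SchwartzMap E2 ℂ) {ψ : E2 → ℂ} (hψ_even : ∀ w, ψ (-w) = ψ w)
    (hψc : Continuous fun φ => ψ (omega φ)) (hψ : ∃ S, ∀ φ, ‖ψ (omega φ)‖ ≤ S) (x : E2) (φ : ℝ) :
    ψ (omega φ) * filtProj f (omega φ) ⟪x, omega φ⟫
      = (1 / (8 * (π : ℂ) ^ 2)) * ((∫ r in Set.Ioi 0, polarKernel f ψ x r φ)
          + ∫ r in Set.Ioi 0, polarKernel f ψ x r (φ + π)) := by
  set g : ℝ → ℂ := fun q => ψ (omega φ) * (Complex.exp (Complex.I * (⟪x, omega φ⟫ : ℝ) * q)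
    * (|q| : ℝ) * FT f (q • omega φ)) with hg
  have hpos : ∀ r ∈ Set.Ioi (0 : ℝ), g r = polarKernel f ψ x r φ := by
    intro r hr
    simp only [hg, polarKernel, abs_of_pos (Set.mem_Ioi.1 hr), inner_smul_right]
    push_cast
    ring_nf
  have hneg : ∀ r ∈ Set.Ioi (0 : ℝ), g (-r) = polarKernel f ψ x r (φ + π) := by
    intro r hr
    simp only [hg, polarKernel, abs_neg, abs_of_pos (Set.mem_Ioi.1 hr), inner_smul_right,
      omega_add_pi, hψ_even, neg_smul, smul_neg, inner_neg_right]
    push_cast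
    ring_nf
  have hgi : Integrable g := by
    refine (integrable_polarKernel f hψc hψ x φ).norm.mono' ?_ (Filter.Eventually.of_forall ?_)
    · have h1 := continuous_FT f
      exact Continuous.aestronglyMeasurable (by fun_prop)
    · intro q
      rw [norm_polarKernel]
      simp only [hg, norm_mul, Complex.norm_real, Real.norm_eq_abs, abs_abs]
      rw [mul_assoc Complex.I, ← Complex.ofReal_mul, norm_exp_I_mul]
      exact le_of_eq (by ring)
  have hsplit : ∫ q, g q = (∫ r in Set.Ioi 0, polarKernel f ψ x r φ)
      + ∫ r in Set.Ioi 0, polarKernel f ψ x r (φ + π) := by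
    rw [← intervalIntegral.integral_Iic_add_Ioi (b := 0) hgi.integrableOn hgi.integrableOn,
      add_comm]
    congr 1
    · exact setIntegral_congr_fun measurableSet_Ioi hpos
    · have := integral_comp_neg_Ioi (0 : ℝ) g
      rw [neg_zero] at this
      rw [← this]
      exact setIntegral_congr_fun measurableSet_Ioi hneg
  rw [← hsplit, hg, MeasureTheory.integral_const_mul, filtProj]
  ring

/-- The reconstruction error as a superposition of trapezoidal errors. -/
lemma reconstruction_sub_multiplier_eq (f : SchwartzMap E2 ℂ) {ψ : E2 → ℂ}
    (hψ_even : ∀ w, ψ (-w) = ψ w) (hψc : Continuous fun φ => ψ (omega φ))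
    (hψ : ∃ S, ∀ φ, ‖ψ (omega φ)‖ ≤ S) (x : E2) {m : ℕ} (hm : 1 ≤ m) :
    (2 * (π : ℂ) / (m : ℂ)) * (∑ j ∈ Finset.Icc 1 m,
            ψ (omega (π * (j : ℝ) / (m : ℝ))) *
              filtProj f (omega (π * (j : ℝ) / (m : ℝ))) ⟪x, omega (π * (j : ℝ) / (m : ℝ))⟫)
          - (1 / (4 * (π : ℂ) ^ 2)) *
              ∫ ξ : E2, Complex.exp (Complex.I * (⟪x, ξ⟫ : ℂ)) * ψ (‖ξ‖⁻¹ • ξ) * FT f ξ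
      = (1 / (4 * (π : ℂ) ^ 2)) * ∫ r in Set.Ioi 0, trapErr m (polarKernel f ψ x r) := by
  have hpi : (π : ℂ) ≠ 0 := by exact_mod_cast Real.pi_ne_zero
  have hm0 : (m : ℂ) ≠ 0 := by exact_mod_cast (by omega : m ≠ 0)
  have hmR : (m : ℝ) ≠ 0 := by exact_mod_cast (by omega : m ≠ 0)
  have hK := integrable_uncurry_polarKernel f hψc hψ x
  rw [← trapErr_integral m (fun φ => (integrable_polarKernel f hψc hψ x φ).restrict) hK, trapErr,
    mul_sub]
  congr 1
  · simp_rw [mul_filtProj_eq f hψ_even hψc hψ x]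
    rw [← Finset.mul_sum, Finset.sum_add_distrib]
    set P : ℝ → ℂ := fun φ => ∫ r in Set.Ioi 0, polarKernel f ψ x r φ
    have hsum : ∑ j ∈ Finset.Icc 1 (2 * m), P (π * (j : ℝ) / m)
        = ∑ j ∈ Finset.Icc 1 m, P (π * (j : ℝ) / m)
          + ∑ j ∈ Finset.Icc 1 m, P (π * (j : ℝ) / m + π) := by
      have h1 : ∀ k, Finset.Icc 1 k = Finset.Ico 1 (k + 1) := fun k => rfl
      rw [h1, h1, ← Finset.sum_Ico_consecutive _ (by omega : 1 ≤ m + 1)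
        (by omega : m + 1 ≤ 2 * m + 1)]
      congr 1
      rw [show m + 1 = 1 + m by ring, show 2 * m + 1 = (1 + m) + m by ring,
        ← Finset.sum_Ico_add' _ 1 (1 + m) m]
      refine Finset.sum_congr rfl fun j _ => ?_
      congr 1
      push_cast
      field_simp
    rw [hsum]
    field_simp
    ring
  · congr 1
    rw [integral_polar, intervalIntegral.integral_of_le (by linarith [Real.pi_pos])]
    rw [← integral_integral_swap hK, integral_integral hK,
      ← Measure.restrict_congr_set (Ioo_ae_eq_Ioc (μ := volume)), Measure.prod_restrict,
      ← Measure.volume_eq_prod]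
    refine setIntegral_congr_fun (measurableSet_Ioi.prod measurableSet_Ioo) fun p hp => ?_
    have hp1 : 0 < p.1 := hp.1
    have : ‖p.1 • omega p.2‖⁻¹ • p.1 • omega p.2 = omega p.2 := by
      rw [norm_smul_omega, abs_of_pos hp1, smul_smul, inv_mul_cancel₀ hp1.ne', one_smul]
    simp only [this, polarKernel]

/-- A square-integrable function supported in the ball of radius `R` has `L¹` norm controlled by
its `L²` norm. -/
lemma integral_norm_le_of_support {R : ℝ} (f : SchwartzMap E2 ℂ) (hf : ∀ x, R < ‖x‖ → f x = 0) :
    ∫ x, ‖f x‖ ≤ (volume (Metric.closedBall (0 : E2) R)).toReal + ∫ x, ‖f x‖ ^ 2 := by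
  have hsq : Integrable fun x => ‖f x‖ ^ 2 :=
    (memLp_two_iff_integrable_sq_norm f.continuous.aestronglyMeasurable).1 (f.memLp 2 volume)
  have hfin : volume (Metric.closedBall (0 : E2) R) ≠ ⊤ := measure_closedBall_lt_top.ne
  have hind : Integrable ((Metric.closedBall (0 : E2) R).indicator fun _ => (1 : ℝ)) :=
    (integrable_indicator_iff Metric.isClosed_closedBall.measurableSet).2
      (integrableOn_const hfin)
  have h1 : ∫ x, (Metric.closedBall (0 : E2) R).indicator (fun _ => (1 : ℝ)) x
      = (volume (Metric.closedBall (0 : E2) R)).toReal := by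
    rw [MeasureTheory.integral_indicator Metric.isClosed_closedBall.measurableSet]
    simp [Measure.real]
  rw [← h1, ← MeasureTheory.integral_add hind hsq]
  refine integral_mono f.integrable.norm (hind.add hsq) fun x => ?_
  by_cases hx : R < ‖x‖
  · simp only [hf x hx, norm_zero]
    have : 0 ≤ (Metric.closedBall (0 : E2) R).indicator (fun _ => (1 : ℝ)) x :=
      Set.indicator_nonneg (fun _ _ => zero_le_one) x
    positivity
  · have hmem : x ∈ Metric.closedBall (0 : E2) R := by simpa using not_lt.1 hx
    simp only [Set.indicator_of_mem hmem]
    nlinarith [sq_nonneg (‖f x‖ - 1 / 2)]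

/-- A semiclassically band limited family has polynomially bounded `L¹` norms. -/
lemma SCBandLimited.exists_integral_norm_le {R B s : ℝ} (hs : 0 < s) {f : ℕ → SchwartzMap E2 ℂ}
    (hf : SCBandLimited R B s f) :
    ∃ C : ℝ, 0 ≤ C ∧ ∃ M : ℕ, ∀ m : ℕ, 1 ≤ m → ∫ x, ‖f m x‖ ≤ C * (m : ℝ) ^ M := by
  obtain ⟨hsupp, ⟨C, M, hC⟩, -⟩ := hf
  have hpi := Real.pi_pos
  refine ⟨(volume (Metric.closedBall (0 : E2) R)).toReal + (C * (s / π) ^ M) ^ 2, by positivity,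
    M * 2, fun m hm => (integral_norm_le_of_support (f m) (hsupp m hm)).trans ?_⟩
  have hm1 : (1 : ℝ) ≤ m := by exact_mod_cast hm
  have hmp : 1 ≤ (m : ℝ) ^ (M * 2) := one_le_pow₀ hm1
  have h0 : 0 ≤ ∫ x, ‖f m x‖ ^ 2 := integral_nonneg fun x => by positivity
  have h1 : ∫ x, ‖f m x‖ ^ 2 ≤ (C * (s / π) ^ M) ^ 2 * (m : ℝ) ^ (M * 2) := by
    rw [← Real.sq_sqrt h0, pow_mul, ← mul_pow]
    refine pow_le_pow_left₀ (Real.sqrt_nonneg _) ((hC m hm).trans_eq ?_) 2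
    rw [div_pow, div_pow, mul_pow]
    field_simp
  rw [add_mul]
  exact add_le_add (le_mul_of_one_le_right ENNReal.toReal_nonneg hmp) h1

/-- The trapezoidal error of the polar kernel as an integral over the support of `f`. -/
lemma trapErr_polarKernel_eq (f : SchwartzMap E2 ℂ) {ψ : E2 → ℂ}
    (hψc : Continuous fun φ => ψ (omega φ)) (hψ : ∃ S, ∀ φ, ‖ψ (omega φ)‖ ≤ S)
    (x : E2) (m : ℕ) (r : ℝ) :
    trapErr m (polarKernel f ψ x r) = ∫ y, r * f y * trapErr m fun φ => ψ (omega φ) *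
      Complex.exp (Complex.I * ((r * (x 0 - y 0) * Real.cos φ
        + r * (x 1 - y 1) * Real.sin φ : ℝ) : ℂ)) := by
  obtain ⟨S, hS⟩ := hψ
  set g : E2 → ℝ → ℂ := fun y φ => r * f y * (ψ (omega φ) *
    Complex.exp (Complex.I * ((r * (x 0 - y 0) * Real.cos φ
      + r * (x 1 - y 1) * Real.sin φ : ℝ) : ℂ))) with hg
  have hgc : Continuous (Function.uncurry g) := by
    have h3 : Continuous fun p : E2 × ℝ => ψ (omega p.2) := hψc.comp continuous_snd
    have h4 := f.continuous
    have h5 : Continuous fun p : E2 × ℝ => Complex.exp (Complex.I *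
        ((r * (x 0 - p.1 0) * Real.cos p.2 + r * (x 1 - p.1 1) * Real.sin p.2 : ℝ) : ℂ)) := by
      fun_prop
    exact (continuous_const.mul (h4.comp continuous_fst)).mul (h3.mul h5)
  have hgn : ∀ y φ, ‖g y φ‖ ≤ |r| * ‖f y‖ * S := by
    intro y φ
    simp only [hg]
    rw [norm_mul, norm_mul, norm_mul, norm_exp_I_mul, mul_one, Complex.norm_real, Real.norm_eq_abs]
    gcongr
    exact hS φ
  have hfi : Integrable fun y => |r| * ‖f y‖ * S := (f.integrable.norm.const_mul _).mul_const _
  have hint1 : ∀ φ, Integrable fun y => g y φ := fun φ =>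
    hfi.mono' (hgc.comp (by fun_prop : Continuous fun y : E2 => (y, φ))).aestronglyMeasurable
      (Filter.Eventually.of_forall fun y => hgn y φ)
  have hint2 : Integrable (Function.uncurry g)
      (volume.prod (volume.restrict (Set.Ioc (-π) π))) := by
    have h1 : Integrable (fun p : E2 × ℝ => (|r| * ‖f p.1‖ * S) * 1)
        (volume.prod (volume.restrict (Set.Ioc (-π) π))) :=
      Integrable.mul_prod hfi (integrable_const (1 : ℝ))
    refine h1.mono' hgc.aestronglyMeasurable (Filter.Eventually.of_forall fun p => ?_)
    rw [mul_one]
    exact hgn p.1 p.2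
  have hK : polarKernel f ψ x r = fun φ => ∫ y, g y φ := by
    ext φ
    rw [polarKernel, FT, ← MeasureTheory.integral_const_mul, ← MeasureTheory.integral_const_mul]
    refine integral_congr_ae (Filter.Eventually.of_forall fun y => ?_)
    simp only [hg, inner_smul_right, inner_omega]
    have : Complex.exp (Complex.I * ((r * (x 0 - y 0) * Real.cos φ
          + r * (x 1 - y 1) * Real.sin φ : ℝ) : ℂ))
        = Complex.exp (Complex.I * ((r * (x 0 * Real.cos φ + x 1 * Real.sin φ) : ℝ) : ℂ))
          * Complex.exp (-(Complex.I * ((r * (y 0 * Real.cos φ + y 1 * Real.sin φ) : ℝ) : ℂ))) := by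
      rw [← Complex.exp_add]
      congr 1
      push_cast
      ring
    rw [this]
    ring
  rw [hK, trapErr_integral m hint1 hint2]
  refine integral_congr_ae (Filter.Eventually.of_forall fun y => ?_)
  simp only [hg, trapErr_const_mul]

lemma norm_sq_sub_eq (x y : E2) : ‖x - y‖ ^ 2 = (x 0 - y 0) ^ 2 + (x 1 - y 1) ^ 2 := by
  simp [EuclideanSpace.norm_sq_eq, Fin.sum_univ_two]

/-- Below the Nyquist rate, the trapezoidal error of the polar kernel is controlled by the `L¹`
norm of `f` and the trapezoidal errors of the exponentials. -/
lemma norm_trapErr_polarKernel_le_of_low {R T E : ℝ} {f : SchwartzMap E2 ℂ}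
    (hf : ∀ x, R < ‖x‖ → f x = 0) {ψ : E2 → ℂ}
    (hψc : Continuous fun φ => ψ (omega φ)) (hψ : ∃ S, ∀ φ, ‖ψ (omega φ)‖ ≤ S) {m : ℕ}
    (herr : ∀ α β : ℝ, α ^ 2 + β ^ 2 ≤ T ^ 2 → ‖trapErr m fun φ => ψ (omega φ) *
        Complex.exp (Complex.I * ((α * Real.cos φ + β * Real.sin φ : ℝ) : ℂ))‖ ≤ E)
    {x : E2} (hx : ‖x‖ ≤ R) {r : ℝ} (hr0 : 0 ≤ r) (hr : r * (2 * R) ≤ T) :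
    ‖trapErr m (polarKernel f ψ x r)‖ ≤ r * E * ∫ y, ‖f y‖ := by
  rw [trapErr_polarKernel_eq f hψc hψ, ← MeasureTheory.integral_const_mul]
  refine norm_integral_le_of_norm_le (f.integrable.norm.const_mul _)
    (Filter.Eventually.of_forall fun y => ?_)
  by_cases hy : R < ‖y‖
  · simp [hf y hy]
  · have hxy : ‖x - y‖ ≤ 2 * R := (norm_sub_le _ _).trans (by linarith [not_lt.1 hy])
    have h1 := herr (r * (x 0 - y 0)) (r * (x 1 - y 1)) (by
      rw [mul_pow, mul_pow, ← mul_add, ← norm_sq_sub_eq, ← mul_pow]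
      exact pow_le_pow_left₀ (by positivity)
        ((mul_le_mul_of_nonneg_left hxy hr0).trans hr) 2)
    rw [norm_mul, norm_mul, Complex.norm_real, Real.norm_eq_abs, abs_of_nonneg hr0]
    calc r * ‖f y‖ * _ ≤ r * ‖f y‖ * E := by gcongr
      _ = r * E * ‖f y‖ := by ring

/-- Rapid decay of the trapezoidal error of the polar kernel, uniformly in the radius. -/
lemma SCBandLimited.exists_norm_trapErr_polarKernel_le {R B s : ℝ} (hR : 0 < R) (hB : 0 < B)
    (hs : 0 < s) (hNyq : B < π / (s * R)) {f : ℕ → SchwartzMap E2 ℂ} (hf : SCBandLimited R B s f)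
    {ψ : E2 → ℂ} (hψ : ContDiff ℝ (⊤ : ℕ∞) fun φ => ψ (omega φ))
    (hψb : ∃ S, ∀ φ, ‖ψ (omega φ)‖ ≤ S) (N : ℕ) :
    ∃ C : ℝ, 0 ≤ C ∧ ∀ m : ℕ, 1 ≤ m → ∀ x : E2, ‖x‖ ≤ R → ∀ r : ℝ, 0 < r →
      ‖trapErr m (polarKernel (f m) ψ x r)‖ ≤ C / (m : ℝ) ^ N * ((1 + |r|) ^ 2)⁻¹ := by
  have hpi := Real.pi_pos
  obtain ⟨B', hBB', hB'⟩ := exists_between hNyq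
  have hB'_pos : 0 < B' := hB.trans hBB'
  set κ : ℝ := π / s with hκ
  have hκ0 : 0 < κ := by positivity
  set θ : ℝ := R * B' / κ with hθ
  have hθ0 : 0 ≤ θ := by positivity
  have hθ1 : θ < 1 := by
    rw [hθ, div_lt_one hκ0, hκ, lt_div_iff₀ hs]
    rw [lt_div_iff₀ (by positivity)] at hB'
    linarith
  obtain ⟨C₁, hC₁0, M, hC₁⟩ := hf.exists_integral_norm_le hs
  obtain ⟨C₂, hC₂0, hC₂⟩ := exists_norm_trapErr_exp_le hθ0 hθ1 hψ
    (fun φ => by simp only [omega_add_two_pi]) (N + M + 3)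
  obtain ⟨hsupp, -, hdecay⟩ := hf
  obtain ⟨C₃, hC₃⟩ := hdecay B' hBB' (N + 3)
  obtain ⟨S, hS⟩ := id hψb
  have hS0 : 0 ≤ S := (norm_nonneg _).trans (hS 0)
  set D : ℝ := 1 + B' / κ with hD
  set c : ℝ := min 1 κ with hc
  have hc0 : 0 < c := lt_min one_pos hκ0
  set A₁ : ℝ := C₂ * C₁ * D ^ 3 with hA₁
  set A₂ : ℝ := 4 * π * (S * (|C₃| * κ ^ (N + 3) / c ^ 3)) with hA₂
  have hA₁0 : 0 ≤ A₁ := by positivity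
  have hA₂0 : 0 ≤ A₂ := by positivity
  refine ⟨A₁ + A₂, by positivity, fun m hm x hx r hr => ?_⟩
  have hm1 : (1 : ℝ) ≤ m := by exact_mod_cast hm
  have hm0 : (0 : ℝ) < m := by linarith
  have hh : π / ((m : ℝ) * s) = κ / m := by rw [hκ]; field_simp
  rw [abs_of_pos hr]
  rcases le_total (κ / m * r) B' with hlow | hhigh
  · have hrm : r ≤ B' / κ * m := by
      rw [div_mul_eq_mul_div, div_le_iff₀ hm0] at hlow
      rw [div_mul_eq_mul_div, le_div_iff₀ hκ0]
      linarith
    have h1 := norm_trapErr_polarKernel_le_of_low (E := C₂ / (m : ℝ) ^ (N + M + 3))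
      (hsupp m hm) hψ.continuous hψb (fun α β h => hC₂ m hm α β h) hx hr.le (by
        calc r * (2 * R) ≤ B' / κ * m * (2 * R) := by gcongr
          _ = 2 * θ * m := by rw [hθ]; ring)
    have h2 : (1 + r) ^ 3 ≤ (D * m) ^ 3 := by
      refine pow_le_pow_left₀ (by positivity) ?_ 3
      rw [hD, add_mul, one_mul]
      linarith
    have h3 : r * (1 + r) ^ 2 ≤ (1 + r) ^ 3 := by
      nlinarith [sq_nonneg (1 + r)]
    refine h1.trans ?_
    calc r * (C₂ / (m : ℝ) ^ (N + M + 3)) * ∫ y, ‖f m y‖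
        ≤ r * (C₂ / (m : ℝ) ^ (N + M + 3)) * (C₁ * (m : ℝ) ^ M) := by
          gcongr
          exact hC₁ m hm
      _ = r * (1 + r) ^ 2 * (C₂ * C₁ / (m : ℝ) ^ (N + 3)) * ((1 + r) ^ 2)⁻¹ := by
          rw [show N + M + 3 = N + 3 + M by ring, pow_add _ (N + 3) M]
          field_simp
      _ ≤ (D * m) ^ 3 * (C₂ * C₁ / (m : ℝ) ^ (N + 3)) * ((1 + r) ^ 2)⁻¹ := by
          gcongr
          exact h3.trans h2
      _ = A₁ / (m : ℝ) ^ N * ((1 + r) ^ 2)⁻¹ := by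
          rw [hA₁, pow_add]
          field_simp
      _ ≤ (A₁ + A₂) / (m : ℝ) ^ N * ((1 + r) ^ 2)⁻¹ := by
          gcongr
          linarith
  · have hFT : ∀ φ, ‖FT (f m) (r • omega φ)‖
        ≤ |C₃| * κ ^ (N + 3) / c ^ 3 / (m : ℝ) ^ N / (1 + r) ^ 3 := by
      intro φ
      have hnorm : ‖(κ / m * r) • omega φ‖ = κ / m * r := by
        rw [norm_smul_omega, abs_of_pos (by positivity)]
      have h1 := hC₃ m hm ((κ / m * r) • omega φ) (by rw [hnorm]; exact hhigh)
      rw [hh, hnorm, smul_smul, ← mul_assoc, inv_mul_cancel₀ (by positivity), one_mul] at h1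
      have h2 : c / m * (1 + r) ≤ 1 + κ / m * r := by
        have e1 : c / m ≤ 1 := (div_le_one hm0).2 ((min_le_left _ _).trans hm1)
        have e2 : c / m * r ≤ κ / m * r := by
          gcongr
          exact min_le_right _ _
        linarith
      have h3 : (c / m * (1 + r)) ^ 3 ≤ (1 + κ / m * r) ^ (N + 3) :=
        (pow_le_pow_left₀ (by positivity) h2 3).trans
          (pow_le_pow_right₀ (by linarith [show 0 ≤ κ / m * r by positivity]) (by omega))
      calc ‖FT (f m) (r • omega φ)‖ ≤ C₃ * (κ / m) ^ (N + 3) / (1 + κ / m * r) ^ (N + 3) := h1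
        _ ≤ |C₃| * (κ / m) ^ (N + 3) / (c / m * (1 + r)) ^ 3 := by
          gcongr
          exact le_abs_self _
        _ = _ := by
          rw [div_pow, mul_pow, div_pow, pow_add (m : ℝ)]
          field_simp
    have hK : ∀ φ, ‖polarKernel (f m) ψ x r φ‖
        ≤ S * (|C₃| * κ ^ (N + 3) / c ^ 3 / (m : ℝ) ^ N) * ((1 + r) ^ 2)⁻¹ := by
      intro φ
      refine le_trans ?_ (mul_div_one_add_pow_three_le hr.le (by positivity))
      rw [norm_polarKernel, abs_of_pos hr, mul_div_assoc S]
      gcongr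
      · exact hS φ
      · exact hFT φ
    refine (norm_trapErr_le_of_norm_le hm hK).trans ?_
    calc _ = A₂ / (m : ℝ) ^ N * ((1 + r) ^ 2)⁻¹ := by rw [hA₂]; ring
      _ ≤ (A₁ + A₂) / (m : ℝ) ^ N * ((1 + r) ^ 2)⁻¹ := by
          gcongr
          linarith

lemma Function.Periodic.exists_norm_le {g : ℝ → ℂ} {T : ℝ} (hg : Function.Periodic g T)
    (hT : 0 < T) (hc : Continuous g) : ∃ S, ∀ t, ‖g t‖ ≤ S := by
  obtain ⟨S, hS⟩ := (isCompact_Icc (a := 0) (b := T)).exists_bound_of_continuousOn hc.continuousOn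
  refine ⟨S, fun t => ?_⟩
  obtain ⟨u, hu, hut⟩ := hg.exists_mem_Ico₀ hT t
  rw [hut]
  exact hS u (Set.Ico_subset_Icc_self hu)

/-- Theorem 4.2(b) (no aliasing under the Nyquist condition `B < π/(sR)`):
the discrete reconstruction `f_{ψ,δ,h}` agrees with the Fourier multiplier
`f_{ψ,h}` on `{|x| ≤ R}` up to `O(h^∞)`, where `h = π/(ms)` is the admissible
semiclassical parameter. -/
theorem no_aliasing_under_nyquist (R B s : ℝ) (hR : 0 < R) (hB : 0 < B) (hs : 0 < s)
    (hNyq : B < π / (s * R))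
    (f : ℕ → SchwartzMap E2 ℂ) (hf : SCBandLimited R B s f)
    (ψ : E2 → ℂ) (hψ_smooth : ContDiffOn ℝ (⊤ : ℕ∞) ψ {x : E2 | x ≠ 0})
    (hψ_even : ∀ w : E2, ψ (-w) = ψ w) :
    ∀ N : ℕ, ∃ C : ℝ, ∀ m : ℕ, 1 ≤ m → ∀ x : E2, ‖x‖ ≤ R →
      ‖(2 * (π : ℂ) / (m : ℂ)) * (∑ j ∈ Finset.Icc 1 m,
            ψ (omega (π * (j : ℝ) / (m : ℝ))) *
              filtProj (⇑(f m)) (omega (π * (j : ℝ) / (m : ℝ)))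
                ⟪x, omega (π * (j : ℝ) / (m : ℝ))⟫)
          - (1 / (4 * (π : ℂ) ^ 2)) *
              ∫ ξ : E2, Complex.exp (Complex.I * (⟪x, ξ⟫ : ℂ)) * ψ (‖ξ‖⁻¹ • ξ) * FT (⇑(f m)) ξ‖
        ≤ C * (π / ((m : ℝ) * s)) ^ N := by
  intro N
  have hpi := Real.pi_pos
  have hψ : ContDiff ℝ (⊤ : ℕ∞) fun φ => ψ (omega φ) := by
    rw [← contDiffOn_univ]
    refine hψ_smooth.comp contDiff_omega.contDiffOn fun φ _ => ?_
    have : ‖omega φ‖ ≠ 0 := by simp [norm_omega]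
    exact norm_ne_zero_iff.1 this
  have hψb : ∃ S, ∀ φ, ‖ψ (omega φ)‖ ≤ S :=
    Function.Periodic.exists_norm_le (g := fun φ => ψ (omega φ))
      (fun φ => by simp only [omega_add_two_pi]) Real.two_pi_pos hψ.continuous
  obtain ⟨C, hC0, hC⟩ := hf.exists_norm_trapErr_polarKernel_le hR hB hs hNyq hψ hψb N
  set J : ℝ := ∫ r in Set.Ioi (0 : ℝ), ((1 + |r|) ^ 2)⁻¹ with hJ
  refine ⟨1 / (4 * π ^ 2) * (C * (s / π) ^ N * J), fun m hm x hx => ?_⟩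
  have hm0 : (m : ℝ) ≠ 0 := by exact_mod_cast (by omega : m ≠ 0)
  rw [reconstruction_sub_multiplier_eq (f m) hψ_even hψ.continuous hψb x hm, norm_mul]
  have h1 : ‖(1 / (4 * (π : ℂ) ^ 2))‖ = 1 / (4 * π ^ 2) := by
    simp [abs_of_pos hpi]
  have h2 : ‖∫ r in Set.Ioi 0, trapErr m (polarKernel (f m) ψ x r)‖ ≤ C / (m : ℝ) ^ N * J := by
    rw [hJ, ← MeasureTheory.integral_const_mul]
    exact norm_integral_le_of_norm_le (integrable_one_add_abs_sq_inv.const_mul _).restrict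
      ((ae_restrict_iff' measurableSet_Ioi).2
        (Filter.Eventually.of_forall fun r hr => hC m hm x hx r hr))
  rw [h1, mul_assoc]
  refine mul_le_mul_of_nonneg_left (h2.trans_eq ?_) (by positivity)
  rw [div_pow, div_pow, mul_pow]
  field_simp
end
end

section
/- Proposition A.2, backward direction: Let B ≥ 0 and let (f_h)_{h∈(0,1]} be a family of smooth 2π-periodic functions ℝ → ℂ such that there exist C, M with ‖f_h‖_{L²(0,2π)} ≤ C h^{−M} for all h, and such that for every B′ > B and every N there is C_N with |∫_0^{2π} e^{−i n φ} f_h(φ) dφ| ≤ C_N (1 + |n|)^{−N} for all h ∈ (0,1] and all integers n with |n| ≥ B′/h. Then for every χ ∈ C_c^∞(ℝ), every B′ > B and every N there is C′ such that |∫_ℝ e^{−i φ ξ/h} χ(φ) f_h(φ) dφ| ≤ C′ (h/|ξ|)^N for all h ∈ (0,1] and all ξ with |ξ| ≥ B′. -/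
open MeasureTheory Real intervalIntegral

noncomputable section

/-- The semiclassical Fourier transform `𝓕_h g(ξ) = ∫ e^{−i x ξ/h} g(x) dx`. -/
def FTh (h : ℝ) (g : ℝ → ℂ) (ξ : ℝ) : ℂ :=
  ∫ x : ℝ, Complex.exp (-(Complex.I * (x : ℂ) * (ξ : ℂ) / (h : ℂ))) * g x

open scoped FourierTransform

theorem summable_inv_one_add_abs_sq :
    Summable fun n : ℤ => 1 / (1 + |(n : ℝ)|) ^ 2 := by
  have h : Summable fun n : ℤ => 1 / (n : ℝ) ^ 2 :=
    Real.summable_one_div_int_pow.mpr one_lt_two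
  refine Summable.of_norm_bounded_eventually h ?_
  have h0 : ∀ᶠ n : ℤ in Filter.cofinite, n ≠ 0 :=
    Filter.eventually_cofinite_ne 0
  filter_upwards [h0] with n hn
  have hn' : 0 < |(n : ℝ)| := abs_pos.mpr (by exact_mod_cast hn)
  rw [Real.norm_of_nonneg (by positivity), ← sq_abs (n : ℝ)]
  gcongr
  linarith

/-- Fourier inversion on the circle of length `2π`, for summable coefficients. -/
theorem hasSum_fourier_of_periodic {f : ℝ → ℂ} (hf : Continuous f)
    (hper : Function.Periodic f (2 * π))
    (hsum : Summable fun n : ℤ =>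
      ∫ φ in (0 : ℝ)..(2 * π), Complex.exp (-(Complex.I * (n : ℂ) * (φ : ℂ))) * f φ)
    (x : ℝ) :
    HasSum (fun n : ℤ => (1 / (2 * π) : ℂ) *
      (∫ φ in (0 : ℝ)..(2 * π), Complex.exp (-(Complex.I * (n : ℂ) * (φ : ℂ))) * f φ) *
        Complex.exp (Complex.I * (n : ℂ) * (x : ℂ))) (f x) := by
  have : Fact (0 < 2 * π) := ⟨two_pi_pos⟩
  have hpi : (π : ℂ) ≠ 0 := by exact_mod_cast pi_ne_zero
  let F : C(AddCircle (2 * π), ℂ) :=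
    ⟨hper.lift, continuous_coinduced_dom.mpr hf⟩
  have hcoeff : ∀ n : ℤ, fourierCoeff F n = (1 / (2 * π) : ℂ) *
      ∫ φ in (0 : ℝ)..(2 * π), Complex.exp (-(Complex.I * (n : ℂ) * (φ : ℂ))) * f φ := by
    intro n
    rw [fourierCoeff_eq_intervalIntegral F n 0, zero_add, Complex.real_smul]
    push_cast
    congr 1
    refine intervalIntegral.integral_congr fun y _ => ?_
    simp only [smul_eq_mul, fourier_coe_apply, F, ContinuousMap.coe_mk,
      Function.Periodic.lift_coe]
    congr 2
    push_cast
    field_simp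
  have hF : Summable (fourierCoeff F) := by
    rw [funext hcoeff]
    exact hsum.mul_left _
  have key := has_pointwise_sum_fourier_series_of_summable hF (x : AddCircle (2 * π))
  have hFx : F (x : AddCircle (2 * π)) = f x := Function.Periodic.lift_coe hper x
  rw [hFx] at key
  refine key.congr_fun ?_
  intro n
  rw [hcoeff, smul_eq_mul, fourier_coe_apply]
  congr 2
  push_cast
  field_simp

/-- The Fourier transform of a test function decays faster than any power. -/
theorem exists_FTh_one_le {χ : ℝ → ℂ} (hχ : ContDiff ℝ (⊤ : ℕ∞) χ)
    (hsupp : HasCompactSupport χ) (K : ℕ) :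
    ∃ D : ℝ, 0 ≤ D ∧ ∀ t : ℝ, ‖FTh 1 χ t‖ ≤ D / (1 + |t|) ^ K := by
  let g : SchwartzMap ℝ ℂ := hsupp.toSchwartzMap hχ
  obtain ⟨D, hD⟩ : ∃ D : ℝ, ∀ w : ℝ, (1 + ‖w‖) ^ K * ‖(𝓕 g) w‖ ≤ D := by
    refine ⟨2 ^ K * (Finset.Iic (K, 0)).sup (fun m => SchwartzMap.seminorm ℝ m.1 m.2) (𝓕 g),
      fun w => ?_⟩
    simpa only [norm_iteratedFDeriv_zero] using
      SchwartzMap.one_add_le_sup_seminorm_apply (𝕜 := ℝ) (m := (K, 0)) le_rfl le_rfl (𝓕 g) w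
  have hD0 : 0 ≤ D := le_trans (by positivity) (hD 0)
  refine ⟨(2 * π) ^ K * D, by positivity, fun t => ?_⟩
  have hpi : (π : ℂ) ≠ 0 := by exact_mod_cast pi_ne_zero
  have heq : FTh 1 χ t = (𝓕 g) (t / (2 * π)) := by
    rw [SchwartzMap.fourier_coe, Real.fourier_real_eq_integral_exp_smul]
    refine integral_congr_ae (Filter.Eventually.of_forall fun x => ?_)
    have hg : g x = χ x := rfl
    simp only [hg, smul_eq_mul]
    congr 2
    push_cast
    field_simp
  rw [heq, le_div_iff₀ (by positivity)]
  have h1 : 1 + |t| ≤ 2 * π * (1 + ‖t / (2 * π)‖) := by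
    rw [norm_div, Real.norm_eq_abs, Real.norm_of_nonneg two_pi_pos.le]
    have := pi_gt_three
    have h2 : 2 * π * (1 + |t| / (2 * π)) = 2 * π + |t| := by field_simp
    linarith
  calc ‖(𝓕 g) (t / (2 * π))‖ * (1 + |t|) ^ K
      ≤ ‖(𝓕 g) (t / (2 * π))‖ * (2 * π * (1 + ‖t / (2 * π)‖)) ^ K := by gcongr
    _ = (2 * π) ^ K * ((1 + ‖t / (2 * π)‖) ^ K * ‖(𝓕 g) (t / (2 * π))‖) := by
        rw [mul_pow]; ring
    _ ≤ (2 * π) ^ K * D := by gcongr; exact hD _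

theorem hasSum_FTh_of_periodic {χ : ℝ → ℂ} (hχ : Continuous χ)
    (hsupp : HasCompactSupport χ) {f : ℝ → ℂ} (hf : Continuous f)
    (hper : Function.Periodic f (2 * π))
    (hsum : Summable fun n : ℤ =>
      ∫ φ in (0 : ℝ)..(2 * π), Complex.exp (-(Complex.I * (n : ℂ) * (φ : ℂ))) * f φ)
    (h ξ : ℝ) :
    HasSum (fun n : ℤ => (1 / (2 * π) : ℂ) *
      (∫ φ in (0 : ℝ)..(2 * π), Complex.exp (-(Complex.I * (n : ℂ) * (φ : ℂ))) * f φ) *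
        FTh 1 χ (ξ / h - n)) (FTh h (fun φ => χ φ * f φ) ξ) := by
  set c : ℤ → ℂ := fun n =>
    ∫ φ in (0 : ℝ)..(2 * π), Complex.exp (-(Complex.I * (n : ℂ) * (φ : ℂ))) * f φ with hc
  let F : ℤ → ℝ → ℂ := fun n x => (1 / (2 * π) : ℂ) * c n *
    (Complex.exp (-(Complex.I * (x : ℂ) * ((ξ / h - n : ℝ) : ℂ) / ((1 : ℝ) : ℂ))) * χ x)
  have hnorm : ∀ n x, ‖F n x‖ = ‖(1 / (2 * π) : ℂ) * c n‖ * ‖χ x‖ := by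
    intro n x
    have : -(Complex.I * (x : ℂ) * ((ξ / h - n : ℝ) : ℂ) / ((1 : ℝ) : ℂ))
        = ((-(x * (ξ / h - n)) : ℝ) : ℂ) * Complex.I := by push_cast; ring
    simp only [F, this]
    rw [norm_mul, norm_mul _ (χ x), Complex.norm_exp_ofReal_mul_I, one_mul]
  have hF_int : ∀ n, Integrable (F n) := by
    intro n
    refine Continuous.integrable_of_hasCompactSupport (by fun_prop) ?_
    exact (hsupp.mul_left).mul_left
  have hF_sum : Summable fun n => ∫ x, ‖F n x‖ := by
    simp_rw [hnorm, MeasureTheory.integral_const_mul]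
    exact (hsum.mul_left _).norm.mul_right _
  have key := hasSum_integral_of_summable_integral_norm hF_int hF_sum
  have h1 : ∀ n, ∫ x, F n x = (1 / (2 * π) : ℂ) * c n * FTh 1 χ (ξ / h - n) := fun n =>
    MeasureTheory.integral_const_mul _ _
  have h2 : ∫ x, ∑' n, F n x = FTh h (fun φ => χ φ * f φ) ξ := by
    refine integral_congr_ae (Filter.Eventually.of_forall fun x => ?_)
    have hx := (hasSum_fourier_of_periodic hf hper hsum x).mul_left
      (Complex.exp (-(Complex.I * (x : ℂ) * (ξ : ℂ) / (h : ℂ))) * χ x)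
    simp only
    rw [← mul_assoc, ← hx.tsum_eq]
    refine tsum_congr fun n => ?_
    have : Complex.exp (-(Complex.I * (x : ℂ) * ((ξ / h - n : ℝ) : ℂ) / ((1 : ℝ) : ℂ)))
        = Complex.exp (-(Complex.I * (x : ℂ) * (ξ : ℂ) / (h : ℂ))) *
          Complex.exp (Complex.I * (n : ℂ) * (x : ℂ)) := by
      rw [← Complex.exp_add]
      congr 1
      push_cast
      ring
    simp only [F, this]
    ring
  rw [h2] at key
  simpa only [h1] using key

theorem norm_circle_coefficient_le {f : ℝ → ℂ} (hf : Continuous f) (n : ℤ) {S : ℝ}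
    (hS : Real.sqrt (∫ φ in Set.Ioc (0 : ℝ) (2 * π), ‖f φ‖ ^ 2) ≤ S) :
    ‖∫ φ in (0 : ℝ)..(2 * π), Complex.exp (-(Complex.I * (n : ℂ) * (φ : ℂ))) * f φ‖
      ≤ 2 * π + S ^ 2 := by
  have hI : ∫ φ in (0 : ℝ)..(2 * π), ‖f φ‖ ^ 2 ≤ S ^ 2 := by
    rw [intervalIntegral.integral_of_le two_pi_pos.le]
    exact (Real.sqrt_le_left (le_trans (Real.sqrt_nonneg _) hS)).mp hS
  calc _ ≤ ∫ φ in (0 : ℝ)..(2 * π), (1 + ‖f φ‖ ^ 2) := by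
        refine intervalIntegral.norm_integral_le_of_norm_le two_pi_pos.le
          (Filter.Eventually.of_forall fun φ _ => ?_)
          (Continuous.intervalIntegrable (by fun_prop) _ _)
        have : -(Complex.I * (n : ℂ) * (φ : ℂ)) = ((-(n * φ) : ℝ) : ℂ) * Complex.I := by
          push_cast; ring
        rw [norm_mul, this, Complex.norm_exp_ofReal_mul_I, one_mul]
        nlinarith [sq_nonneg (‖f φ‖ - 1), sq_nonneg ‖f φ‖]
    _ = 2 * π + ∫ φ in (0 : ℝ)..(2 * π), ‖f φ‖ ^ 2 := by
        rw [intervalIntegral.integral_add (by simp)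
          (Continuous.intervalIntegrable (by fun_prop) _ _)]
        simp
    _ ≤ _ := by gcongr

/-- Peetre-type inequality for a product of two decaying factors. -/
theorem mul_le_of_decay {N : ℕ} {C D u v n t : ℝ} (hv : 0 ≤ v) (ht : 0 < |t|)
    (hD : 0 ≤ D) (hu : u ≤ C / (1 + |n|) ^ (N + 2)) (hu0 : 0 ≤ u)
    (hvD : v ≤ D / (1 + |t - n|) ^ N) :
    u * v ≤ C * D * (1 / (1 + |n|) ^ 2) * (1 / |t|) ^ N := by
  have hC : 0 ≤ C := by
    have := le_trans hu0 hu
    contrapose! this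
    exact div_neg_of_neg_of_pos this (by positivity)
  have hp : |t| ≤ (1 + |n|) * (1 + |t - n|) := by
    have h1 : |t| ≤ |t - n| + |n| := by simpa using abs_add_le (t - n) n
    nlinarith [abs_nonneg n, abs_nonneg (t - n), mul_nonneg (abs_nonneg n) (abs_nonneg (t - n))]
  calc u * v ≤ C / (1 + |n|) ^ (N + 2) * (D / (1 + |t - n|) ^ N) :=
        mul_le_mul hu hvD hv (by positivity)
    _ = C * D * (1 / (1 + |n|) ^ 2) * (1 / ((1 + |n|) * (1 + |t - n|))) ^ N := by
        rw [pow_add, div_pow, mul_pow, one_pow]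
        field_simp
    _ ≤ _ := by gcongr

/-- Off-diagonal bound: the frequency `t` stays at distance at least `κ |t|` from `n`. -/
theorem mul_le_of_frequency_gap {N M : ℕ} {P D u v n t κ β : ℝ} (hv : 0 ≤ v)
    (hP : 0 ≤ P) (hD : 0 ≤ D) (hκ : 0 < κ) (hβ : 0 < β) (ht : β ≤ |t|)
    (hu : u ≤ P * (|t| / β) ^ M) (hn : |n| ≤ |t|) (hgap : κ * |t| ≤ |t - n|)
    (hvD : v ≤ D / (1 + |t - n|) ^ (N + M + 2)) :
    u * v ≤ P * D * (1 / β) ^ M * (1 / κ) ^ (N + M + 2) * (1 + 1 / β) ^ 2 *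
      (1 / (1 + |n|) ^ 2) * (1 / |t|) ^ N := by
  have ht0 : 0 < |t| := hβ.trans_le ht
  have h1 : 1 + |n| ≤ (1 + 1 / β) * |t| := by
    have : 1 ≤ 1 / β * |t| := by rw [one_div_mul_eq_div, le_div_iff₀ hβ]; linarith
    linarith
  calc u * v ≤ P * (|t| / β) ^ M * (D / (κ * |t|) ^ (N + M + 2)) := by
        refine mul_le_mul hu (hvD.trans ?_) hv (by positivity)
        gcongr
        linarith
    _ = P * D * (1 / β) ^ M * (1 / κ) ^ (N + M + 2) * (1 + 1 / β) ^ 2 *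
          (1 / ((1 + 1 / β) * |t|) ^ 2) * (1 / |t|) ^ N := by
        have : 1 + 1 / β ≠ 0 := by positivity
        generalize 1 + 1 / β = w at *
        simp only [div_pow, mul_pow, one_pow, pow_add]
        field_simp
    _ ≤ _ := by gcongr

/-- Proposition A.2, backward direction: if a tempered family of smooth
`2π`-periodic functions has Fourier coefficients `O((1+|n|)^{−∞})` for
`|n| ≥ B′/h` (for every `B′ > B`), then for every `χ ∈ C_c^∞(ℝ)` and every
`B′ > B`, `𝓕_h(χ f_h)(ξ) = O((h/|ξ|)^∞)` for `|ξ| ≥ B′`. -/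
theorem circle_coefficients_band_limit (B : ℝ) (hB : 0 ≤ B)
    (f : ℝ → ℝ → ℂ)
    (hf_smooth : ∀ h ∈ Set.Ioc (0:ℝ) 1, ContDiff ℝ (⊤ : ℕ∞) (f h))
    (hf_per : ∀ h ∈ Set.Ioc (0:ℝ) 1, Function.Periodic (f h) (2 * π))
    (htemp : ∃ C : ℝ, ∃ M : ℕ, ∀ h ∈ Set.Ioc (0:ℝ) 1,
      Real.sqrt (∫ φ in Set.Ioc (0:ℝ) (2 * π), ‖f h φ‖ ^ 2) ≤ C / h ^ M)
    (hcoef : ∀ B' : ℝ, B < B' → ∀ N : ℕ, ∃ C : ℝ,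
      ∀ h ∈ Set.Ioc (0:ℝ) 1, ∀ n : ℤ, B' / h ≤ |(n : ℝ)| →
        ‖∫ φ in (0:ℝ)..(2 * π), Complex.exp (-(Complex.I * (n : ℂ) * (φ : ℂ))) * f h φ‖
          ≤ C / (1 + |(n : ℝ)|) ^ N) :
    ∀ χ : ℝ → ℂ, ContDiff ℝ (⊤ : ℕ∞) χ → HasCompactSupport χ →
      ∀ B' : ℝ, B < B' → ∀ N : ℕ, ∃ C' : ℝ,
        ∀ h ∈ Set.Ioc (0:ℝ) 1, ∀ ξ : ℝ, B' ≤ |ξ| →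
          ‖FTh h (fun φ => χ φ * f h φ) ξ‖ ≤ C' * (h / |ξ|) ^ N := by
  intro χ hχ hsupp B' hB' N
  obtain ⟨C, M, hC⟩ := htemp
  have hB'0 : 0 < B' := hB.trans_lt hB'
  obtain ⟨b, hBb, hbB'⟩ := exists_between hB'
  have hb0 : 0 < b := hB.trans_lt hBb
  obtain ⟨C₁, hC₁⟩ := hcoef b hBb (N + 2)
  obtain ⟨D₁, hD₁0, hD₁⟩ := exists_FTh_one_le hχ hsupp N
  obtain ⟨D₂, hD₂0, hD₂⟩ := exists_FTh_one_le hχ hsupp (N + 2 * M + 2)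
  set κ : ℝ := 1 - b / B' with hκ_def
  have hκ : 0 < κ := sub_pos.mpr ((div_lt_one hB'0).mpr hbB')
  set A : ℝ := (2 * π + C ^ 2) * D₂ * (1 / B') ^ (2 * M) * (1 / κ) ^ (N + 2 * M + 2) *
    (1 + 1 / B') ^ 2 with hA
  have hA0 : 0 ≤ A := by positivity
  have hs := summable_inv_one_add_abs_sq
  refine ⟨1 / (2 * π) * ((|C₁| * D₁ + A) * ∑' n : ℤ, 1 / (1 + |(n : ℝ)|) ^ 2), ?_⟩
  intro h hh ξ hξ
  have hh0 : 0 < h := hh.1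
  set c : ℤ → ℂ := fun n =>
    ∫ φ in (0 : ℝ)..(2 * π), Complex.exp (-(Complex.I * (n : ℂ) * (φ : ℂ))) * f h φ with hc
  have habs : |ξ / h| = |ξ| / h := by rw [abs_div, abs_of_pos hh0]
  have ht1 : B' / h ≤ |ξ / h| := by rw [habs]; gcongr
  have ht : B' ≤ |ξ / h| := le_trans (le_div_self hB'0.le hh0 hh.2) ht1
  have ht0 : 0 < |ξ / h| := hB'0.trans_le ht
  have hterm : ∀ n : ℤ, ‖c n‖ * ‖FTh 1 χ (ξ / h - n)‖ ≤
      (|C₁| * D₁ + A) * (1 / (1 + |(n : ℝ)|) ^ 2) * (1 / |ξ / h|) ^ N := by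
    intro n
    rcases le_or_gt (b / h) |(n : ℝ)| with hn | hn
    · refine (mul_le_of_decay (C := |C₁|) (norm_nonneg _) ht0 hD₁0 ((hC₁ h hh n hn).trans ?_)
        (norm_nonneg _) (hD₁ _)).trans ?_
      · gcongr
        exact le_abs_self _
      · gcongr
        linarith
    · have hbt : b / h ≤ b / B' * |ξ / h| := by
        calc b / h = b / B' * (B' / h) := by field_simp
          _ ≤ _ := by gcongr
      have hcn : ‖c n‖ ≤ (2 * π + C ^ 2) * (|ξ / h| / B') ^ (2 * M) := by
        refine (norm_circle_coefficient_le (hf_smooth h hh).continuous n (hC h hh)).trans ?_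
        have h1 : 1 / h ≤ |ξ / h| / B' := by
          rw [le_div_iff₀ hB'0, one_div_mul_eq_div]
          exact ht1
        have h2 : 1 ≤ (1 / h) ^ (2 * M) := one_le_pow₀ (by rw [le_div_iff₀ hh0]; linarith [hh.2])
        calc 2 * π + (C / h ^ M) ^ 2 = 2 * π * 1 + C ^ 2 * (1 / h) ^ (2 * M) := by
              rw [div_pow, div_pow, one_pow, ← pow_mul, mul_comm M 2]; ring
          _ ≤ 2 * π * (1 / h) ^ (2 * M) + C ^ 2 * (1 / h) ^ (2 * M) := by gcongr
          _ = (2 * π + C ^ 2) * (1 / h) ^ (2 * M) := by ring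
          _ ≤ _ := by gcongr
      have hgap : κ * |ξ / h| ≤ |ξ / h - n| := by
        have := abs_sub_abs_le_abs_sub (ξ / h) n
        rw [hκ_def, sub_mul, one_mul]
        linarith
      have hnt : |(n : ℝ)| ≤ |ξ / h| := by
        have := mul_pos hκ ht0
        rw [hκ_def, sub_mul, one_mul] at this
        linarith
      refine (mul_le_of_frequency_gap (norm_nonneg _) (by positivity) hD₂0 hκ hB'0 ht hcn hnt
        hgap (hD₂ _)).trans ?_
      rw [← hA]
      gcongr
      linarith [mul_nonneg (abs_nonneg C₁) hD₁0]
  have hsum : Summable c := by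
    refine Summable.of_norm_bounded_eventually (hs.mul_left |C₁|) ?_
    have hfin : ∀ᶠ n : ℤ in Filter.cofinite, b / h ≤ |(n : ℝ)| :=
      (tendsto_norm_cocompact_atTop (E := ℝ)).comp Int.tendsto_coe_cofinite
        |>.eventually_ge_atTop (b / h)
    filter_upwards [hfin] with n hn
    refine (hC₁ h hh n hn).trans ?_
    rw [mul_one_div]
    gcongr
    · exact le_abs_self _
    · linarith [abs_nonneg (n : ℝ)]
    · omega
  have hS := hasSum_FTh_of_periodic hχ.continuous hsupp (hf_smooth h hh).continuous
    (hf_per h hh) hsum h ξ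
  have hbound := ((hs.hasSum.mul_left (|C₁| * D₁ + A)).mul_right ((1 / |ξ / h|) ^ N)).mul_left
    (1 / (2 * π))
  have hle := tsum_of_norm_bounded hbound (f := fun n : ℤ =>
    (1 / (2 * π) : ℂ) * c n * FTh 1 χ (ξ / h - n)) fun n => by
      rw [norm_mul, norm_mul, mul_assoc]
      have : ‖(1 / (2 * π) : ℂ)‖ = 1 / (2 * π) := by
        simp [abs_of_pos pi_pos]
      rw [this]
      exact mul_le_mul_of_nonneg_left (hterm n) (by positivity)
  rw [hS.tsum_eq] at hle
  refine hle.trans_eq ?_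
  rw [habs, one_div_div]
  ring
end
end
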